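/- arXiv:1611.01478 — 3 statements merged into one kernel-verified Lean document; each statement's English description precedes it below -/
import Mathlib

section
/- For every integer n ≥ 2, the number of basketball walks of length n from 0 to 0 that visit 1 and are positive except at their extremities (C-walks) is equal to the (n-1)-st Catalan number. -/
/-- Height of a walk (given by its list of steps) after `i` steps. -/
def ht (s : List ℤ) (i : ℕ) : ℤ := (s.take i).sum

/-- A basketball walk: every step lies in `{-2, -1, 1, 2}`. -/
def IsBasketball (s : List ℤ) : Prop := ∀ x ∈ s, x = -2 ∨ x = -1 ∨ x = 1 ∨ x = 2

/-- A C-walk: a basketball walk from 0 to 0 that visits 1 and is positive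
except at its extremities. -/
def IsCWalk (s : List ℤ) : Prop :=
  IsBasketball s ∧ ht s s.length = 0 ∧
    (∀ i, 0 < i → i < s.length → 0 < ht s i) ∧ ∃ i, i ≤ s.length ∧ ht s i = 1

/-- A G-walk: a basketball walk from 0 to 1 that is positive except at the origin. -/
def IsGWalk (s : List ℤ) : Prop :=
  IsBasketball s ∧ ht s s.length = 1 ∧ ∀ i, 1 ≤ i → i ≤ s.length → 0 < ht s i

/-- An A-walk (basketball excursion): a nonnegative basketball walk from 0 to 0. -/
def IsAWalk (s : List ℤ) : Prop :=
  IsBasketball s ∧ ht s s.length = 0 ∧ ∀ i, i ≤ s.length → 0 ≤ ht s i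

/-- A B-walk: a basketball walk from 0 to 1 that visits 0 and 1 only at its extremities. -/
def IsBWalk (s : List ℤ) : Prop :=
  IsBasketball s ∧ ht s s.length = 1 ∧
    ∀ i, 0 < i → i < s.length → ht s i ≠ 0 ∧ ht s i ≠ 1

/-- Number of `±1`-steps of a walk. -/
noncomputable def pmOneSteps (s : List ℤ) : ℕ :=
  Set.ncard {i : ℕ | i < s.length ∧ (s.getD i 0 = 1 ∨ s.getD i 0 = -1)}

/-- Number of steps that are odd `+2`-steps or even `-2`-steps
(the step of index `i`, 0-based, starts at height `ht s i`). -/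
noncomputable def lSteps (s : List ℤ) : ℕ :=
  Set.ncard {i : ℕ | i < s.length ∧
    ((s.getD i 0 = 2 ∧ Odd (ht s i)) ∨ (s.getD i 0 = -2 ∧ Even (ht s i)))}

/-- Number of steps that are odd `-2`-steps or even `+2`-steps. -/
noncomputable def rSteps (s : List ℤ) : ℕ :=
  Set.ncard {i : ℕ | i < s.length ∧
    ((s.getD i 0 = -2 ∧ Odd (ht s i)) ∨ (s.getD i 0 = 2 ∧ Even (ht s i)))}

/-- The (0-based) steps of indices `i < j` are paired: the `i`-th step is a `+2`,
the `j`-th step is a `-2`, the walk after step `j` is back at the height it had before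
step `i`, and strictly in between the walk stays at least one above that height. -/
def Paired (s : List ℤ) (i j : ℕ) : Prop :=
  i < j ∧ j < s.length ∧ s.getD i 0 = 2 ∧ s.getD j 0 = -2 ∧
    ht s (j + 1) = ht s i ∧ ∀ k, i + 1 < k → k ≤ j → ht s i + 1 ≤ ht s k

/-- A staggered `±2`-step: a `±2`-step that is not paired with any other `±2`-step. -/
def IsStaggered (s : List ℤ) (i : ℕ) : Prop :=
  i < s.length ∧ (s.getD i 0 = 2 ∨ s.getD i 0 = -2) ∧
    (∀ j, ¬ Paired s i j) ∧ ∀ j, ¬ Paired s j i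

/-- Number of staggered `±2`-steps of a walk. -/
noncomputable def staggeredCount (s : List ℤ) : ℕ :=
  Set.ncard {i : ℕ | IsStaggered s i}

open Finset PowerSeries

/-- The steps allowed in a basketball walk. -/
def basketballSteps : Finset ℤ := {-2, -1, 1, 2}

/-- The lists made of an allowed step `x` followed by an element of `A x`. -/
def stepCons (A : ℤ → Finset (List ℤ)) : Finset (List ℤ) :=
  basketballSteps.biUnion fun x => (A x).image (List.cons x)

lemma mem_stepCons_cons {A : ℤ → Finset (List ℤ)} {x : ℤ} {t : List ℤ} :
    x :: t ∈ stepCons A ↔ x ∈ basketballSteps ∧ t ∈ A x := by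
  simp [stepCons]

lemma nil_notMem_stepCons {A : ℤ → Finset (List ℤ)} : [] ∉ stepCons A := by
  simp [stepCons]

lemma card_stepCons (A : ℤ → Finset (List ℤ)) :
    #(stepCons A) = ∑ x ∈ basketballSteps, #(A x) := by
  rw [stepCons, card_biUnion]
  · exact sum_congr rfl fun x _ => card_image_of_injective _ (List.cons_injective)
  · intro x _ y _ hxy
    rw [Function.onFun, disjoint_left]
    rintro s hs hs'
    simp only [mem_image] at hs hs'
    obtain ⟨t, -, rfl⟩ := hs
    obtain ⟨t', -, h⟩ := hs'
    exact hxy (List.cons.inj h).1.symm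

lemma sum_basketballSteps {M : Type*} [AddCommMonoid M] (g : ℤ → M) :
    ∑ x ∈ basketballSteps, g x = g (-2) + (g (-1) + (g 1 + g 2)) := by
  simp [basketballSteps]

/-- The basketball walks of length `n` from `h` to `0` that stay at height at least `m`
before their last step. -/
def descents (m : ℤ) : ℕ → ℤ → Finset (List ℤ)
  | 0, h => if h = 0 then {[]} else ∅
  | n + 1, h => if m ≤ h then stepCons fun x => descents m n (h + x) else ∅

lemma ht_zero (s : List ℤ) : ht s 0 = 0 := by simp [ht]

lemma ht_cons_succ (x : ℤ) (s : List ℤ) (i : ℕ) : ht (x :: s) (i + 1) = x + ht s i := by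
  simp [ht]

lemma isBasketball_cons {x : ℤ} {s : List ℤ} :
    IsBasketball (x :: s) ↔ x ∈ basketballSteps ∧ IsBasketball s := by
  simp [IsBasketball, basketballSteps]

lemma mem_descents {m : ℤ} {n : ℕ} {h : ℤ} {s : List ℤ} :
    s ∈ descents m n h ↔ IsBasketball s ∧ s.length = n ∧ h + ht s n = 0 ∧
      ∀ i < n, m ≤ h + ht s i := by
  induction n generalizing h s with
  | zero =>
    cases s <;> by_cases hh : h = 0 <;> simp [descents, hh, ht, IsBasketball]
  | succ n ih =>
    rw [descents]
    cases s with
    | nil => split_ifs <;> simp [nil_notMem_stepCons]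
    | cons x t =>
      have key : (∀ i < n + 1, m ≤ h + ht (x :: t) i) ↔
          m ≤ h ∧ ∀ i < n, m ≤ h + x + ht t i := by
        simp only [Nat.forall_lt_succ_left', ht_zero, ht_cons_succ, add_zero, add_assoc]
      rw [key, isBasketball_cons, ht_cons_succ, ← add_assoc]
      split_ifs with hm
      · rw [mem_stepCons_cons, ih]
        simp [hm, and_assoc]
      · simp [hm]

lemma card_descents_succ {m h : ℤ} (hm : m ≤ h) (n : ℕ) :
    #(descents m (n + 1) h) = ∑ x ∈ basketballSteps, #(descents m n (h + x)) := by
  rw [descents, if_pos hm, card_stepCons]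

lemma descents_mono {m m' : ℤ} (hm : m ≤ m') (n : ℕ) (h : ℤ) :
    descents m' n h ⊆ descents m n h := fun s hs => by
  rw [mem_descents] at hs ⊢
  exact ⟨hs.1, hs.2.1, hs.2.2.1, fun i hi => hm.trans (hs.2.2.2 i hi)⟩

lemma card_descents_eq_coeff {m : ℤ} {f : ℤ → ℤ⟦X⟧} (hm : 0 < m)
    (hlt : ∀ h < m, f h = if h = 0 then 1 else 0)
    (hge : ∀ h, m ≤ h → f h = X * (f (h - 2) + (f (h - 1) + (f (h + 1) + f (h + 2)))))
    (n : ℕ) (h : ℤ) : (#(descents m n h) : ℤ) = coeff n (f h) := by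
  induction n generalizing h with
  | zero =>
    by_cases hh : h < m
    · rw [hlt h hh]
      by_cases h0 : h = 0 <;> simp [descents, h0]
    · rw [hge h (not_lt.1 hh)]
      have : h ≠ 0 := by lia
      simp [descents, this]
  | succ n ih =>
    by_cases hh : h < m
    · rw [hlt h hh, descents, if_neg (not_le.2 hh)]
      by_cases h0 : h = 0 <;> simp [h0, coeff_one]
    · rw [card_descents_succ (not_lt.1 hh), hge h (not_lt.1 hh), coeff_succ_X_mul,
        sum_basketballSteps]
      push_cast
      simp only [ih, map_add, sub_eq_add_neg]

/-- The solution of the recurrence `t (h + 2) = g * t (h + 1) + a * t h` with initial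
values `1` and `g`. -/
def lucasSeq {R : Type*} [CommRing R] (g a : R) : ℕ → R
  | 0 => 1
  | 1 => g
  | h + 2 => g * lucasSeq g a (h + 1) + a * lucasSeq g a h

lemma lucasSeq_kernel {R : Type*} [CommRing R] {z g a : R}
    (h₁ : g = z * (1 + (lucasSeq g a 2 + lucasSeq g a 3)))
    (h₂ : lucasSeq g a 2 = z * (1 + (g + (lucasSeq g a 3 + lucasSeq g a 4)))) (h : ℕ) :
    lucasSeq g a (h + 2) = z * (lucasSeq g a h + (lucasSeq g a (h + 1) +
      (lucasSeq g a (h + 3) + lucasSeq g a (h + 4)))) := by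
  induction h using Nat.twoStepInduction with
  | zero => exact h₂
  | one =>
    simp only [lucasSeq] at h₁ h₂ ⊢
    linear_combination g * h₂ + a * h₁
  | more h ih₁ ih₂ =>
    simp only [lucasSeq] at ih₁ ih₂ ⊢
    linear_combination g * ih₂ + a * ih₁

/-- A power series with zero constant coefficient is of the form `g + g ^ 2`. -/
lemma exists_add_sq_eq {R : Type*} [CommRing R] {f : R⟦X⟧} (hf : constantCoeff f = 0) :
    ∃ g : R⟦X⟧, constantCoeff g = 0 ∧ g + g ^ 2 = f := by
  have hs : HasSubst (-f) := HasSubst.of_constantCoeff_zero' (by simp [hf])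
  set c : R⟦X⟧ := (catalanSeries.map (Nat.castRingHom R)) with hc
  have hc1 : c ^ 2 * X + 1 = c := by
    have := congrArg (PowerSeries.map (Nat.castRingHom R)) catalanSeries_sq_mul_X_add_one
    simpa using this
  have h := congrArg (substAlgHom (R := R) hs) hc1
  simp only [map_add, map_mul, map_pow, map_one, substAlgHom_X] at h
  refine ⟨f * substAlgHom (R := R) hs c, by simp [hf], ?_⟩
  linear_combination -f * h

/-- Here `g` counts the positive walks from `0` to `1`, and `a` the excursions, with their length
shifted by one. -/
lemma exists_kernel_solution : ∃ g a : ℤ⟦X⟧,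
    (∀ n ≠ 0, coeff n (g + g ^ 2) = (catalan n : ℤ)) ∧
    g = X * (1 + (lucasSeq g a 2 + lucasSeq g a 3)) ∧
    lucasSeq g a 2 = X * (1 + (g + (lucasSeq g a 3 + lucasSeq g a 4))) ∧
    a = X * (1 + a * (g + lucasSeq g a 2)) := by
  set c : ℤ⟦X⟧ := (catalanSeries.map (Nat.castRingHom ℤ)) with hc
  have hc1 : c ^ 2 * X + 1 = c := by
    have := congrArg (PowerSeries.map (Nat.castRingHom ℤ)) catalanSeries_sq_mul_X_add_one
    simpa using this
  obtain ⟨g, hg0, hg⟩ := exists_add_sq_eq (f := c - 1) (by rw [← hc1]; simp)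
  have hu : IsUnit (1 + g) := isUnit_iff_constantCoeff.2 (by simp [hg0])
  obtain ⟨b, hb⟩ := hu.exists_right_inv
  have hF : g + g ^ 2 = X * (1 + g + g ^ 2) ^ 2 := by
    have : c = 1 + g + g ^ 2 := by linear_combination -hg
    rw [this] at hc1
    linear_combination -hc1
  have ha : (1 + g) * (g * b) = g := by linear_combination g * hb
  generalize g * b = a at ha
  have h₁ : g = X * (1 + (lucasSeq g a 2 + lucasSeq g a 3)) := by
    simp only [lucasSeq]
    apply hu.mul_left_cancel
    linear_combination hF - X * (1 + 2 * g) * ha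
  have h₃ : a = X * (1 + a * (g + lucasSeq g a 2)) := by
    simp only [lucasSeq]
    apply (hu.pow 2).mul_left_cancel
    linear_combination hF + (1 + g - X * ((g + g ^ 2) * (1 + g) + (1 + g) * a + g)) * ha
  refine ⟨g, a, fun n hn => ?_, h₁, ?_, h₃⟩
  · rw [hg]
    simp [hc, coeff_one, hn]
  · simp only [lucasSeq] at h₁ h₃ ⊢
    linear_combination g * h₁ + h₃

lemma isCWalk_cons_iff {n : ℕ} (hn : n ≠ 0) {x : ℤ} {t : List ℤ} :
    IsCWalk (x :: t) ∧ (x :: t).length = n + 1 ↔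
      x ∈ basketballSteps ∧ t ∈ descents 1 n x \ descents 2 n x := by
  rw [mem_sdiff, mem_descents, mem_descents, IsCWalk, isBasketball_cons]
  constructor
  · rintro ⟨⟨⟨hx, hb⟩, h0, hpos, i, hi, h1⟩, hl⟩
    have hl' : t.length = n := by simpa using hl
    rw [hl] at h0 hpos hi
    rw [ht_cons_succ] at h0
    refine ⟨hx, ⟨hb, hl', h0, fun j hj => ?_⟩, fun h => ?_⟩
    · have := hpos (j + 1) (by lia) (by lia)
      rw [ht_cons_succ] at this
      lia
    · cases i with
      | zero => simp [ht_zero] at h1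
      | succ i =>
        rw [ht_cons_succ] at h1
        rcases (Nat.le_of_succ_le_succ hi).lt_or_eq with hi' | rfl
        · have := h.2.2.2 i hi'
          lia
        · lia
  · rintro ⟨hx, ⟨hb, hl, h0, h1⟩, h2⟩
    have h3 : ∃ i < n, x + ht t i < 2 := by
      by_contra! h
      exact h2 ⟨hb, hl, h0, h⟩
    obtain ⟨i, hi, hi2⟩ := h3
    have hl' : (x :: t).length = n + 1 := by simp [hl]
    rw [hl']
    refine ⟨⟨⟨hx, hb⟩, by rw [ht_cons_succ, h0], fun j hj hjn => ?_, i + 1, by lia, ?_⟩, rfl⟩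
    · obtain ⟨j, rfl⟩ := Nat.exists_eq_succ_of_ne_zero hj.ne'
      rw [Nat.succ_eq_add_one, ht_cons_succ]
      have := h1 j (by lia)
      lia
    · rw [ht_cons_succ]
      have := h1 i hi
      lia

lemma card_isCWalk {n : ℕ} (hn : n ≠ 0) :
    Nat.card {s : List ℤ // IsCWalk s ∧ s.length = n + 1} =
      ∑ x ∈ basketballSteps, #(descents 1 n x \ descents 2 n x) := by
  rw [← card_stepCons fun x => descents 1 n x \ descents 2 n x]
  refine Nat.subtype_card _ fun s => ?_
  cases s with
  | nil => simp [nil_notMem_stepCons]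
  | cons x t => rw [isCWalk_cons_iff hn, mem_stepCons_cons]

/-- For every integer `n ≥ 2`, the number of basketball walks of length `n` from 0 to 0
that visit 1 and are positive except at their extremities is the `(n-1)`-st Catalan number. -/
theorem stmt0 (n : ℕ) (hn : 2 ≤ n) :
    Nat.card {s : List ℤ // IsCWalk s ∧ s.length = n} = catalan (n - 1) := by
  obtain ⟨n, rfl⟩ := Nat.exists_eq_add_of_le' (one_le_two.trans hn)
  have hn0 : n ≠ 0 := by lia
  obtain ⟨g, a, hg, h₁, h₂, h₃⟩ := exists_kernel_solution
  let f : ℤ → ℤ⟦X⟧ := fun h => if h < 0 then 0 else lucasSeq g a h.toNat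
  have hneg : ∀ h < 0, f h = 0 := fun h hh => if_pos hh
  have hnat : ∀ k : ℕ, f k = lucasSeq g a k := fun k => by simp [f]
  have hf0 : f 0 = 1 := hnat 0
  have hf1 : f 1 = g := hnat 1
  have hf2 : f 2 = lucasSeq g a 2 := hnat 2
  have hf3 : f 3 = lucasSeq g a 3 := hnat 3
  have hrec : ∀ h, 1 ≤ h →
      f h = X * (f (h - 2) + (f (h - 1) + (f (h + 1) + f (h + 2)))) := by
    intro h hh
    obtain ⟨k, rfl⟩ := Int.eq_ofNat_of_zero_le (sub_nonneg.2 hh) |>.imp fun k hk =>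
      eq_add_of_sub_eq hk
    cases k with
    | zero => simpa [hf0, hf1, hf2, hf3, hneg] using h₁
    | succ k =>
      have := lucasSeq_kernel h₁ h₂ k
      simp only [← hnat] at this
      convert this using 5 <;> push_cast <;> ring_nf
  have hcard₁ := card_descents_eq_coeff (f := f) one_pos
    (fun h hh => by
      split_ifs with h0
      · rw [h0, hf0]
      · exact hneg h (by lia)) hrec n
  have hcard₂ := card_descents_eq_coeff (m := 2) (f := fun h => if h = 0 then 1 else a * f (h - 2))
    two_pos
    (fun h hh => by
      split_ifs with h0
      · rfl
      · rw [hneg _ (by lia), mul_zero])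
    (fun h hh => by
      rcases hh.eq_or_lt with rfl | hh
      · simpa [hf0, hf1, hf2, hneg, mul_add] using h₃
      · have e : ∀ k : ℤ, 0 < k → (if k = 0 then (1 : ℤ⟦X⟧) else a * f (k - 2)) = a * f (k - 2) :=
          fun k hk => if_neg hk.ne'
        simp only [e h (by lia), e (h - 2) (by lia), e (h - 1) (by lia), e (h + 1) (by lia),
          e (h + 2) (by lia)]
        rw [hrec (h - 2) (by lia)]
        ring_nf) n
  rw [card_isCWalk hn0, Nat.add_sub_cancel, ← Nat.cast_inj (R := ℤ), ← hg n hn0]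
  push_cast
  simp only [cast_card_sdiff (descents_mono one_le_two n _), hcard₁, hcard₂, sum_basketballSteps]
  norm_num [hf0, hf1, hf2, hneg, lucasSeq]
  rw [sq]
end

section
/- For integers d ≥ 1, ℓ ≥ 0 and r ≥ 0, the number of basketball walks from 0 to 0 that visit 1 and are positive except at their extremities, having exactly 2d steps of value ±1, exactly ℓ steps that are odd +2-steps or even -2-steps, and exactly r steps that are odd -2-steps or even +2-steps, is equal to (1/d)·binomial(2d-2, d-1)·binomial(ℓ+r+2d-2, ℓ+r)·binomial(ℓ+r, ℓ). -/
namespace BasketballWalk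

open PowerSeries

/-- The allowed steps of a basketball walk. -/
def steps : Finset ℤ := {-2, -1, 1, 2}

/-- The basketball walks with a given number of steps. -/
def walks : ℕ → Finset (List ℤ)
  | 0 => {[]}
  | n + 1 => (steps ×ˢ walks n).image fun p => p.1 :: p.2

theorem isBasketball_cons {x : ℤ} {s : List ℤ} :
    IsBasketball (x :: s) ↔ x ∈ steps ∧ IsBasketball s := by
  simp [IsBasketball, steps]

theorem mem_walks {n : ℕ} {s : List ℤ} : s ∈ walks n ↔ IsBasketball s ∧ s.length = n := by
  induction n generalizing s with
  | zero =>
    rw [walks, Finset.mem_singleton, List.length_eq_zero_iff]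
    exact ⟨fun h => ⟨by simp [h, IsBasketball], h⟩, fun h => h.2⟩
  | succ n ih =>
    cases s with
    | nil => simp [walks]
    | cons x s => simp [walks, isBasketball_cons, ih, and_assoc]

theorem sum_walks_succ {M : Type*} [AddCommMonoid M] (n : ℕ) (f : List ℤ → M) :
    ∑ s ∈ walks (n + 1), f s = ∑ x ∈ steps, ∑ s ∈ walks n, f (x :: s) := by
  rw [walks, Finset.sum_image, Finset.sum_product]
  rintro ⟨x, s⟩ - ⟨y, t⟩ - h
  simpa using h

/-- The walk with steps `s` started at height `h` ends at height `t`, and all its earlier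
vertices are at height greater than `c`. -/
def StopsAt (c t : ℤ) : ℤ → List ℤ → Prop
  | h, [] => h = t
  | h, x :: s => c < h ∧ StopsAt c t (h + x) s

theorem ht_cons_succ (x : ℤ) (s : List ℤ) (i : ℕ) : ht (x :: s) (i + 1) = x + ht s i := by
  simp [ht]

theorem stopsAt_iff {c t h : ℤ} {s : List ℤ} :
    StopsAt c t h s ↔ h + ht s s.length = t ∧ ∀ i < s.length, c < h + ht s i := by
  induction s generalizing h with
  | nil => simp [StopsAt, ht]
  | cons x s ih =>
    simp only [StopsAt, ih, List.length_cons, Nat.forall_lt_succ_left', ht_cons_succ, add_assoc]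
    simp only [ht, List.take_zero, List.sum_nil, add_zero]
    tauto

theorem isCWalk_cons {x : ℤ} {s : List ℤ} :
    IsCWalk (x :: s) ↔ IsBasketball (x :: s) ∧ StopsAt 0 0 x s ∧ ¬ StopsAt 1 0 x s := by
  simp only [IsCWalk, stopsAt_iff, List.length_cons, ht_cons_succ]
  refine and_congr_right fun _ => ?_
  constructor
  · rintro ⟨h0, hpos, i, hi, h1⟩
    have hi0 : i ≠ 0 := by rintro rfl; simp [ht] at h1
    obtain ⟨j, rfl⟩ := Nat.exists_eq_succ_of_ne_zero hi0
    rw [Nat.succ_eq_add_one, ht_cons_succ] at h1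
    refine ⟨⟨h0, fun k hk => ?_⟩, fun h => ?_⟩
    · simpa [ht_cons_succ] using hpos (k + 1) (by omega) (by omega)
    · rcases (show j ≤ s.length by omega).lt_or_eq with hj | rfl
      · have := h.2 j hj
        omega
      · omega
  · rintro ⟨⟨h0, hpos⟩, hn⟩
    push Not at hn
    obtain ⟨j, hj, hj1⟩ := hn h0
    have hj0 := hpos j hj
    refine ⟨h0, fun k hk hk' => ?_, j + 1, by omega, by rw [ht_cons_succ]; omega⟩
    obtain ⟨k, rfl⟩ := Nat.exists_eq_succ_of_ne_zero hk.ne'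
    rw [Nat.succ_eq_add_one, ht_cons_succ]
    exact hpos k (by omega)

theorem not_isCWalk_nil : ¬ IsCWalk [] := by
  simp [IsCWalk, ht]

theorem StopsAt.mono {c c' t h : ℤ} {s : List ℤ} (hc : c ≤ c') (hs : StopsAt c' t h s) :
    StopsAt c t h s := by
  rw [stopsAt_iff] at hs ⊢
  exact ⟨hs.1, fun i hi => hc.trans_lt (hs.2 i hi)⟩

/-- The weight of a step `x` starting at height `h`. -/
def stepWeight {K : Type*} (z a b : K) (h x : ℤ) : K :=
  if x = 1 ∨ x = -1 then z
  else if (x = 2 ∧ Odd h) ∨ (x = -2 ∧ Even h) then a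
  else b

theorem stepWeight_add_two {K : Type*} (z a b : K) (h x : ℤ) :
    stepWeight z a b (h + 2) x = stepWeight z a b h x := by
  simp [stepWeight, parity_simps]

section GeneratingFunctions

variable {K : Type*} [CommRing K] (z a b : K)

/-- The weight of a walk started at height `h`: the product of the weights of its steps. -/
def walkWeight : ℤ → List ℤ → K
  | _, [] => 1
  | h, x :: s => stepWeight z a b h x * walkWeight (h + x) s

open scoped Classical in
/-- The generating function, by length, of the walks from `h` to `t` all of whose vertices
before the last one are at height greater than `c`. -/
noncomputable def hitSeries (c t h : ℤ) : K⟦X⟧ :=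
  mk fun n => ∑ s ∈ walks n, if StopsAt c t h s then walkWeight z a b h s else 0

/-- The first-step recurrence, valid above height `c`. -/
def IsHarmonic (c : ℤ) (f : ℤ → K⟦X⟧) : Prop :=
  ∀ h, c < h → f h = X * ∑ x ∈ steps, C (stepWeight z a b h x) * f (h + x)

variable {z a b}

theorem IsHarmonic.mono {c c' : ℤ} {f : ℤ → K⟦X⟧} (hf : IsHarmonic z a b c f) (hc : c ≤ c') :
    IsHarmonic z a b c' f :=
  fun h hh => hf h (hc.trans_lt hh)

theorem IsHarmonic.eq_zero {c : ℤ} {f : ℤ → K⟦X⟧} (hf : IsHarmonic z a b c f)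
    (h0 : f c = 0) (h1 : f (c - 1) = 0) {h : ℤ} (hh : c - 1 ≤ h) : f h = 0 := by
  ext n
  induction n generalizing h with
  | zero =>
    rcases lt_or_ge c h with hc | hc
    · simp [hf h hc]
    · obtain rfl | rfl : h = c ∨ h = c - 1 := by omega
      all_goals simp [h0, h1]
  | succ n ih =>
    rcases lt_or_ge c h with hc | hc
    · rw [hf h hc, coeff_succ_X_mul, map_sum, map_zero]
      refine Finset.sum_eq_zero fun x hx => ?_
      rw [coeff_C_mul, ih, map_zero, mul_zero]
      simp only [steps, Finset.mem_insert, Finset.mem_singleton] at hx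
      omega
    · obtain rfl | rfl : h = c ∨ h = c - 1 := by omega
      all_goals simp [h0, h1]

theorem hitSeries_of_le {c t h : ℤ} (hh : h ≤ c) :
    hitSeries z a b c t h = if h = t then 1 else 0 := by
  ext n
  rw [hitSeries, coeff_mk]
  cases n with
  | zero => split_ifs <;> simp_all [walks, StopsAt, walkWeight]
  | succ n =>
    rw [sum_walks_succ]
    simp only [StopsAt, hh.not_gt, false_and, if_false, Finset.sum_const_zero]
    split_ifs <;> simp [coeff_one]

theorem isHarmonic_hitSeries {c t : ℤ} (ht : t ≤ c) :
    IsHarmonic z a b c (hitSeries z a b c t) := by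
  intro h hh
  ext n
  cases n with
  | zero =>
    have : h ≠ t := by omega
    simp [hitSeries, walks, StopsAt, this]
  | succ n =>
    rw [coeff_succ_X_mul, hitSeries, coeff_mk, sum_walks_succ, map_sum]
    refine Finset.sum_congr rfl fun x _ => ?_
    rw [coeff_C_mul, hitSeries, coeff_mk, Finset.mul_sum]
    refine Finset.sum_congr rfl fun s _ => ?_
    by_cases hs : StopsAt c t (h + x) s <;> simp [StopsAt, hh, hs, walkWeight]

theorem IsHarmonic.eq_hitSeries {c : ℤ} {f : ℤ → K⟦X⟧} (hf : IsHarmonic z a b c f) {h : ℤ}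
    (hh : c - 1 ≤ h) :
    f h = f c * hitSeries z a b c c h + f (c - 1) * hitSeries z a b c (c - 1) h := by
  have key : IsHarmonic z a b c fun k =>
      f k - (f c * hitSeries z a b c c k + f (c - 1) * hitSeries z a b c (c - 1) k) := by
    intro k hk
    simp only [hf k hk, isHarmonic_hitSeries le_rfl k hk,
      isHarmonic_hitSeries (sub_one_lt c).le k hk, Finset.mul_sum, ← Finset.sum_add_distrib,
      ← Finset.sum_sub_distrib]
    refine Finset.sum_congr rfl fun x _ => ?_
    ring
  refine sub_eq_zero.mp (key.eq_zero ?_ ?_ hh) <;> simp [hitSeries_of_le, (sub_one_lt c).ne']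

theorem hitSeries_add_two {c t h : ℤ} (ht : t ≤ c) (hh : c - 1 ≤ h) :
    hitSeries z a b (c + 2) (t + 2) (h + 2) = hitSeries z a b c t h := by
  have key : IsHarmonic z a b c fun k =>
      hitSeries z a b (c + 2) (t + 2) (k + 2) - hitSeries z a b c t k := by
    intro k hk
    simp only
    rw [isHarmonic_hitSeries (by omega) (k + 2) (by omega), isHarmonic_hitSeries ht k hk,
      ← mul_sub, ← Finset.sum_sub_distrib]
    simp only [stepWeight_add_two, mul_sub, add_right_comm]
  refine sub_eq_zero.mp (key.eq_zero ?_ ?_ hh) <;> simp [hitSeries_of_le]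

theorem ne_zero_of_constantCoeff_eq_one [Nontrivial K] {f : K⟦X⟧} (hf : constantCoeff f = 1) :
    f ≠ 0 := by
  rintro rfl
  simp at hf

theorem exists_mul_eq_one_of_constantCoeff_eq_one {f : K⟦X⟧} (hf : constantCoeff f = 1) :
    ∃ g, f * g = 1 :=
  (isUnit_iff_constantCoeff.mpr (hf ▸ isUnit_one)).exists_right_inv

/-- Elimination of the auxiliary series from the first-step equations. The two parities of the
ground level turn out to give the same series `e` of excursions. -/
theorem quadratic_of_first_step [IsDomain K] {Z A B x y x' y' : K⟦X⟧}
    (hZ : constantCoeff Z = 0) (hA : constantCoeff A = 0) (hB : constantCoeff B = 0)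
    (hx : x = Z * (x * x' + y') + Z + A * (x * (x' * x + y) + y' * x))
    (hy : y = Z * (y * x') + A * (y * (x' * x + y)) + B)
    (hx' : x' = Z * (x' * x + y) + Z + B * (x' * (x * x' + y') + y * x'))
    (hy' : y' = Z * (y' * x) + B * (y' * (x * x' + y')) + A) :
    Z * x + B * (x * x') =
      Z ^ 2 + (A + B) * (Z * x + B * (x * x')) + (Z * x + B * (x * x')) ^ 2 := by
  obtain ⟨e, he⟩ := exists_mul_eq_one_of_constantCoeff_eq_one
    (f := 1 - Z * x' - A * (x * x') - A * y) (by simp [hZ, hA])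
  obtain ⟨e', he'⟩ := exists_mul_eq_one_of_constantCoeff_eq_one
    (f := 1 - Z * x - B * (x * x') - B * y') (by simp [hZ, hB])
  obtain rfl : y = B * e := by linear_combination e * hy - y * he
  obtain rfl : y' = A * e' := by linear_combination e' * hy' - y' * he'
  have hxe : x * (1 - A ^ 2 * e * e') = Z * e * (1 + A * e') := by
    linear_combination e * hx - x * he
  have hxe' : x' * (1 - B ^ 2 * e * e') = Z * e' * (1 + B * e) := by
    linear_combination e' * hx' - x' * he'
  obtain rfl : e = e' := by
    have key : (e - e') * ((1 - A * B * e * e') *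
        ((1 - A ^ 2 * e * e') * (1 - B ^ 2 * e * e') + e * e' * Z ^ 2)) = 0 := by
      linear_combination
        (1 - A ^ 2 * e * e') * (1 - B ^ 2 * e * e') * (e' * he - e * he') -
          e * e' * ((Z + (B - A) * x') * (1 - B ^ 2 * e * e') * hxe +
            ((B - A) * Z * e * (1 + A * e') - Z * (1 - A ^ 2 * e * e')) * hxe')
    rcases mul_eq_zero.mp key with h | h
    · exact sub_eq_zero.mp h
    · refine absurd h (mul_ne_zero ?_ ?_) <;>
        exact ne_zero_of_constantCoeff_eq_one (by simp [hZ, hA, hB])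
  have hxe₁ : x * (1 - A * e) = Z * e := by
    have : (1 + A * e) * (x * (1 - A * e) - Z * e) = 0 := by linear_combination hxe
    refine sub_eq_zero.mp ((mul_eq_zero.mp this).resolve_left ?_)
    exact ne_zero_of_constantCoeff_eq_one (by simp [hA])
  have hxe₁' : x' * (1 - B * e) = Z * e := by
    have : (1 + B * e) * (x' * (1 - B * e) - Z * e) = 0 := by linear_combination hxe'
    refine sub_eq_zero.mp ((mul_eq_zero.mp this).resolve_left ?_)
    exact ne_zero_of_constantCoeff_eq_one (by simp [hB])
  have hc : (Z * x + B * (x * x')) * (1 - A * e) * (1 - B * e) = Z ^ 2 * e := by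
    linear_combination B * x * (1 - A * e) * hxe₁' + Z * hxe₁
  have he0 : e ≠ 0 := by
    rintro rfl
    simp at he
  refine mul_left_cancel₀ he0 ?_
  linear_combination hc + (Z * x + B * (x * x')) * he'

variable (z a b) in
open scoped Classical in
/-- The generating function of C-walks by length. -/
noncomputable def cWalkSeries : K⟦X⟧ :=
  mk fun n => ∑ s ∈ walks n, if IsCWalk s then walkWeight z a b 0 s else 0

theorem sum_steps_even {h : ℤ} (hh : Even h) (f : ℤ → K⟦X⟧) :
    X * ∑ x ∈ steps, C (stepWeight z a b h x) * f (h + x) =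
      C a * X * f (h - 2) + C z * X * f (h - 1) + C z * X * f (h + 1) + C b * X * f (h + 2) := by
  have : ¬ Odd h := by simpa
  simp [steps, stepWeight, hh, this, ← sub_eq_add_neg]
  ring

theorem sum_steps_odd {h : ℤ} (hh : Odd h) (f : ℤ → K⟦X⟧) :
    X * ∑ x ∈ steps, C (stepWeight z a b h x) * f (h + x) =
      C b * X * f (h - 2) + C z * X * f (h - 1) + C z * X * f (h + 1) + C a * X * f (h + 2) := by
  have : ¬ Even h := by simpa
  simp [steps, stepWeight, hh, this, ← sub_eq_add_neg]
  ring

theorem cWalkSeries_eq :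
    cWalkSeries z a b = C z * X * hitSeries z a b 0 0 1 +
      C b * X * (hitSeries z a b 0 0 2 - hitSeries z a b 1 0 2) := by
  have key : cWalkSeries z a b = X * ∑ x ∈ steps,
      C (stepWeight z a b 0 x) * (hitSeries z a b 0 0 (0 + x) - hitSeries z a b 1 0 (0 + x)) := by
    ext n
    cases n with
    | zero => simp [cWalkSeries, walks, not_isCWalk_nil]
    | succ n =>
      rw [coeff_succ_X_mul, cWalkSeries, coeff_mk, sum_walks_succ, map_sum]
      refine Finset.sum_congr rfl fun x hx => ?_
      rw [coeff_C_mul, map_sub, hitSeries, hitSeries, coeff_mk, coeff_mk,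
        ← Finset.sum_sub_distrib, Finset.mul_sum]
      refine Finset.sum_congr rfl fun s hs => ?_
      have hb : IsBasketball (x :: s) := isBasketball_cons.mpr ⟨hx, (mem_walks.mp hs).1⟩
      have hmono : StopsAt 1 0 x s → StopsAt 0 0 x s := StopsAt.mono zero_le_one
      by_cases h0 : StopsAt 0 0 x s <;> by_cases h1 : StopsAt 1 0 x s <;>
        simp_all [isCWalk_cons, walkWeight]
  rw [key, sum_steps_even Even.zero fun x => hitSeries z a b 0 0 x - hitSeries z a b 1 0 x]
  simp [hitSeries_of_le]

theorem cWalkSeries_quadratic [IsDomain K] :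
    cWalkSeries z a b =
      (C z * X) ^ 2 + (C a * X + C b * X) * cWalkSeries z a b + cWalkSeries z a b ^ 2 := by
  have shift₀ (t : ℤ) (ht : t ≤ 0) {h : ℤ} (hh : 0 ≤ h) :
      hitSeries z a b 0 t h = hitSeries z a b 0 t 1 * hitSeries z a b 1 1 h +
        hitSeries z a b 0 t 0 * hitSeries z a b 1 0 h := by
    simpa using ((isHarmonic_hitSeries (z := z) (a := a) (b := b) ht).mono
      zero_le_one).eq_hitSeries (h := h) (by simpa)
  have shift₁ (t : ℤ) (ht : t ≤ 1) {h : ℤ} (hh : 1 ≤ h) :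
      hitSeries z a b 1 t (h + 2) = hitSeries z a b 1 t 2 * hitSeries z a b 0 0 h +
        hitSeries z a b 1 t 1 * hitSeries z a b 0 (-1) h := by
    rw [← hitSeries_add_two (c := 0) (t := 0) le_rfl (by omega),
      ← hitSeries_add_two (c := 0) (t := -1) (by omega) (by omega)]
    simpa using ((isHarmonic_hitSeries (z := z) (a := a) (b := b) ht).mono
      one_le_two).eq_hitSeries (h := h + 2) (by omega)
  have first₁ (t : ℤ) (ht : t ≤ 0) :=
    (isHarmonic_hitSeries (z := z) (a := a) (b := b) ht 1 one_pos).trans (sum_steps_odd odd_one _)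
  have first₂ (t : ℤ) (ht : t ≤ 1) :=
    (isHarmonic_hitSeries (z := z) (a := a) (b := b) ht 2 one_lt_two).trans
      (sum_steps_even even_two _)
  have hφ := first₁ 0 le_rfl
  have hψ := first₁ (-1) (by simp)
  have hφ' := first₂ 1 le_rfl
  have hψ' := first₂ 0 zero_le_one
  norm_num [hitSeries_of_le] at hφ hψ hφ' hψ'
  have φ₂ := shift₀ 0 le_rfl (h := 2) (by simp)
  have φ₃ := shift₀ 0 le_rfl (h := 3) (by simp)
  have ψ₂ := shift₀ (-1) (by simp) (h := 2) (by simp)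
  have ψ₃ := shift₀ (-1) (by simp) (h := 3) (by simp)
  have φ₃' := shift₁ 1 le_rfl (h := 1) le_rfl
  have φ₄' := shift₁ 1 le_rfl (h := 2) one_le_two
  have ψ₃' := shift₁ 0 zero_le_one (h := 1) le_rfl
  have ψ₄' := shift₁ 0 zero_le_one (h := 2) one_le_two
  norm_num [hitSeries_of_le] at φ₂ φ₃ ψ₂ ψ₃ φ₃' φ₄' ψ₃' ψ₄'
  rw [φ₄', φ₃', φ₂, ψ₂] at hφ'
  rw [ψ₄', ψ₃', φ₂] at hψ'
  rw [φ₃, φ₂, φ₃', ψ₃'] at hφ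
  rw [ψ₃, ψ₂, φ₃'] at hψ
  have hc : cWalkSeries z a b = C z * X * hitSeries z a b 0 0 1 +
      C b * X * (hitSeries z a b 0 0 1 * hitSeries z a b 1 1 2) := by
    rw [cWalkSeries_eq, φ₂]
    ring
  rw [hc]
  apply quadratic_of_first_step (y := hitSeries z a b 0 (-1) 1) (y' := hitSeries z a b 1 0 2)
  any_goals simp
  · linear_combination hφ
  · linear_combination hψ
  · linear_combination hφ'
  · linear_combination hψ'

theorem coeff_of_quadratic [IsDomain K] {z u : K} {f : K⟦X⟧} (h0 : constantCoeff f = 0)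
    (hf : f = (C z * X) ^ 2 + C u * X * f + f ^ 2) (n : ℕ) :
    coeff n f = ∑ k ∈ Finset.range n, if 2 * k + 2 ≤ n then
      (catalan k : K) * (z ^ (2 * k + 2) * (((n - 2).choose (2 * k) : K) * u ^ (n - (2 * k + 2))))
      else 0 := by
  obtain ⟨w, hw, hwpow⟩ : ∃ w : K⟦X⟧, (1 - C u * X) * w = 1 ∧
      ∀ k, w ^ (k + 1) = mk fun m => u ^ m * ((k + m).choose k : K) := by
    refine ⟨rescale u (mk 1), ?_, fun k => ?_⟩
    · have := congrArg (rescale u) (mk_one_mul_one_sub_eq_one K)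
      rw [map_mul, map_sub, map_one, rescale_X] at this
      rw [mul_comm, this]
    · rw [← map_pow, mk_one_pow_eq_mk_choose_add, rescale_mk]
  set q : K⟦X⟧ := (C z * X * w) ^ 2 with hq
  have hq0 : HasSubst q := HasSubst.of_constantCoeff_zero' (by simp [hq])
  set c : K⟦X⟧ := catalanSeries.map (Nat.castRingHom K) with hc
  have hcX : c ^ 2 * X + 1 = c := by
    simpa using congrArg (PowerSeries.map (Nat.castRingHom K)) catalanSeries_sq_mul_X_add_one
  set s : K⟦X⟧ := substAlgHom (R := K) hq0 c with hs
  have hsq : s ^ 2 * q + 1 = s := by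
    simpa [substAlgHom_X] using congrArg (substAlgHom (R := K) hq0) hcX
  have hfs : f = (C z * X) ^ 2 * w * s := by
    set D := (C z * X) ^ 2 * w * s with hD
    have hDq : D = (C z * X) ^ 2 + C u * X * D + D ^ 2 := by
      linear_combination (C z * X) ^ 2 * s * hw - (C z * X) ^ 2 * hsq
    have : (f - D) * (1 - C u * X - f - D) = 0 := by linear_combination hf - hDq
    refine sub_eq_zero.mp ((mul_eq_zero.mp this).resolve_right ?_)
    exact ne_zero_of_constantCoeff_eq_one (by simp [h0, hD])
  have hsum : ∃ r, s = ∑ k ∈ Finset.range n, (catalan k : K⟦X⟧) * q ^ k + q ^ n * r := by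
    refine ⟨substAlgHom (R := K) hq0 (mk fun i => coeff (i + n) c), ?_⟩
    rw [hs]
    nth_rw 1 [eq_X_pow_mul_shift_add_trunc n c]
    rw [map_add, map_mul, map_pow, substAlgHom_X, substAlgHom_coe, add_comm]
    have htrunc : trunc n c = ∑ k ∈ Finset.range n, Polynomial.monomial k (catalan k : K) := by
      ext i
      simp [hc, coeff_trunc, Polynomial.coeff_monomial]
    simp [htrunc, Polynomial.aeval_monomial]
  obtain ⟨r, hr⟩ := hsum
  have htail : coeff n ((C z * X) ^ 2 * w * (q ^ n * r)) = 0 := by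
    refine X_pow_dvd_iff.mp (?_ : X ^ (n + 1) ∣ _) n n.lt_succ_self
    refine dvd_trans (pow_dvd_pow X (show n + 1 ≤ 2 * n + 2 by omega)) ?_
    exact ⟨C z ^ 2 * w * (C z * w) ^ (2 * n) * r, by rw [hq]; ring⟩
  rw [hfs, hr, mul_add, map_add, htail, add_zero, Finset.mul_sum, map_sum]
  refine Finset.sum_congr rfl fun k _ => ?_
  have : (C z * X) ^ 2 * w * ((catalan k : K⟦X⟧) * q ^ k) =
      C ((catalan k : K) * z ^ (2 * k + 2)) * (w ^ (2 * k + 1) * X ^ (2 * k + 2)) := by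
    rw [hq, map_mul, map_natCast, map_pow]
    ring
  rw [this, coeff_C_mul, coeff_mul_X_pow', hwpow]
  split_ifs with h
  · rw [coeff_mk, show 2 * k + (n - (2 * k + 2)) = n - 2 by omega]
    ring
  · simp

theorem coeff_cWalkSeries [IsDomain K] (n : ℕ) :
    coeff n (cWalkSeries z a b) = ∑ k ∈ Finset.range n, if 2 * k + 2 ≤ n then
      (catalan k : K) *
        (z ^ (2 * k + 2) * (((n - 2).choose (2 * k) : K) * (a + b) ^ (n - (2 * k + 2))))
      else 0 := by
  refine coeff_of_quadratic ?_ ?_ n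
  · simp [cWalkSeries, walks, not_isCWalk_nil]
  · rw [map_add, add_mul]
    exact cWalkSeries_quadratic

end GeneratingFunctions

open scoped Classical in
/-- The number of steps `x` of a walk started at height `h` that satisfy `p k x`, where `k` is the
height at which the step starts. -/
noncomputable def stepCount (p : ℤ → ℤ → Prop) : ℤ → List ℤ → ℕ
  | _, [] => 0
  | h, x :: s => stepCount p (h + x) s + if p h x then 1 else 0

theorem ncard_eq_stepCount (p : ℤ → ℤ → Prop) (h : ℤ) (s : List ℤ) :
    Set.ncard {i : ℕ | i < s.length ∧ p (h + ht s i) (s.getD i 0)} = stepCount p h s := by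
  classical
  have hcount (n : ℕ) (P : ℕ → Prop) : Set.ncard {i : ℕ | i < n ∧ P i} = Nat.count P n := by
    rw [Nat.count_eq_card_filter_range, ← Set.ncard_coe_finset]
    simp
  rw [hcount]
  induction s generalizing h with
  | nil => simp [stepCount]
  | cons x s ih =>
    rw [List.length_cons, Nat.count_succ', stepCount, ← ih]
    simp [add_assoc, ht]

theorem pmOneSteps_eq (s : List ℤ) :
    pmOneSteps s = stepCount (fun _ x => x = 1 ∨ x = -1) 0 s :=
  ncard_eq_stepCount (fun _ x => x = 1 ∨ x = -1) 0 s

theorem lSteps_eq (s : List ℤ) :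
    lSteps s = stepCount (fun h x => (x = 2 ∧ Odd h) ∨ (x = -2 ∧ Even h)) 0 s := by
  rw [← ncard_eq_stepCount]
  simp [lSteps]

theorem rSteps_eq (s : List ℤ) :
    rSteps s = stepCount (fun h x => (x = -2 ∧ Odd h) ∨ (x = 2 ∧ Even h)) 0 s := by
  rw [← ncard_eq_stepCount]
  simp [rSteps]

theorem stepWeight_cases {x : ℤ} (hx : x ∈ steps) (h : ℤ) :
    ((x = 1 ∨ x = -1) ∧ ¬ ((x = 2 ∧ Odd h) ∨ (x = -2 ∧ Even h)) ∧
        ¬ ((x = -2 ∧ Odd h) ∨ (x = 2 ∧ Even h))) ∨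
      (¬ (x = 1 ∨ x = -1) ∧ ((x = 2 ∧ Odd h) ∨ (x = -2 ∧ Even h)) ∧
        ¬ ((x = -2 ∧ Odd h) ∨ (x = 2 ∧ Even h))) ∨
      (¬ (x = 1 ∨ x = -1) ∧ ¬ ((x = 2 ∧ Odd h) ∨ (x = -2 ∧ Even h)) ∧
        ((x = -2 ∧ Odd h) ∨ (x = 2 ∧ Even h))) := by
  simp only [steps, Finset.mem_insert, Finset.mem_singleton] at hx
  rcases Int.even_or_odd h with he | ho
  · have := Int.not_odd_iff_even.mpr he
    rcases hx with rfl | rfl | rfl | rfl <;> simp [he, this]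
  · have := Int.not_even_iff_odd.mpr ho
    rcases hx with rfl | rfl | rfl | rfl <;> simp [ho, this]

theorem walkWeight_eq {K : Type*} [CommRing K] (z a b : K) {s : List ℤ} (hs : IsBasketball s) :
    walkWeight z a b 0 s = z ^ pmOneSteps s * a ^ lSteps s * b ^ rSteps s := by
  rw [pmOneSteps_eq, lSteps_eq, rSteps_eq]
  generalize (0 : ℤ) = h
  induction s generalizing h with
  | nil => simp [walkWeight, stepCount]
  | cons x s ih =>
    rw [isBasketball_cons] at hs
    rw [walkWeight, ih hs.2]
    simp only [stepCount, stepWeight]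
    rcases stepWeight_cases hs.1 h with ⟨h1, h2, h3⟩ | ⟨h1, h2, h3⟩ | ⟨h1, h2, h3⟩ <;>
      simp only [h1, h2, h3, if_true, if_false] <;> ring

theorem pmOneSteps_add_lSteps_add_rSteps {s : List ℤ} (hs : IsBasketball s) :
    pmOneSteps s + lSteps s + rSteps s = s.length := by
  rw [pmOneSteps_eq, lSteps_eq, rSteps_eq]
  generalize (0 : ℤ) = h
  induction s generalizing h with
  | nil => simp [stepCount]
  | cons x s ih =>
    rw [isBasketball_cons] at hs
    rw [List.length_cons, ← ih hs.2 (h + x)]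
    simp only [stepCount]
    rcases stepWeight_cases hs.1 h with ⟨h1, h2, h3⟩ | ⟨h1, h2, h3⟩ | ⟨h1, h2, h3⟩ <;>
      simp only [h1, h2, h3, if_true, if_false] <;> ring

/-- The exponent vector of a monomial in three variables. -/
noncomputable def exponents (i j k : ℕ) : Fin 3 →₀ ℕ :=
  Finsupp.single 0 i + Finsupp.single 1 j + Finsupp.single 2 k

theorem coeff_exponents (i j k i' j' k' : ℕ) :
    MvPolynomial.coeff (exponents i' j' k')
        (MvPolynomial.X 0 ^ i * MvPolynomial.X 1 ^ j * MvPolynomial.X 2 ^ k :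
          MvPolynomial (Fin 3) ℤ) = if i = i' ∧ j = j' ∧ k = k' then 1 else 0 := by
  simp only [MvPolynomial.X_pow_eq_monomial, MvPolynomial.monomial_mul, mul_one]
  rw [MvPolynomial.coeff_monomial]
  refine if_congr ?_ rfl rfl
  constructor
  · intro h
    have h0 := DFunLike.congr_fun h 0
    have h1 := DFunLike.congr_fun h 1
    have h2 := DFunLike.congr_fun h 2
    simp [exponents] at h0 h1 h2
    exact ⟨h0, h1, h2⟩
  · rintro ⟨rfl, rfl, rfl⟩
    rfl

theorem coeff_exponents_add_pow (i m i' j' k' : ℕ) :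
    MvPolynomial.coeff (exponents i' j' k')
        (MvPolynomial.X 0 ^ i * (MvPolynomial.X 1 + MvPolynomial.X 2) ^ m :
          MvPolynomial (Fin 3) ℤ) =
      if i = i' ∧ m = j' + k' then (m.choose j' : ℤ) else 0 := by
  rw [add_pow, Finset.mul_sum, MvPolynomial.coeff_sum]
  have (j : ℕ) : MvPolynomial.coeff (exponents i' j' k')
      (MvPolynomial.X 0 ^ i * (MvPolynomial.X 1 ^ j * MvPolynomial.X 2 ^ (m - j) *
        (m.choose j : MvPolynomial (Fin 3) ℤ))) =
      if i = i' ∧ j = j' ∧ m - j = k' then (m.choose j : ℤ) else 0 := by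
    rw [← mul_assoc, ← mul_assoc, ← map_natCast (MvPolynomial.C (σ := Fin 3) (R := ℤ)),
      mul_comm, MvPolynomial.coeff_C_mul, coeff_exponents]
    simp
  simp only [this]
  split_ifs with h
  · obtain ⟨rfl, rfl⟩ := h
    rw [Finset.sum_eq_single j'] <;> simp +contextual
  · refine Finset.sum_eq_zero fun j hj => if_neg ?_
    rw [Finset.mem_range] at hj
    omega

theorem card_cWalks (d l r : ℕ) :
    (Nat.card {s : List ℤ //
        IsCWalk s ∧ pmOneSteps s = 2 * d ∧ lSteps s = l ∧ rSteps s = r} : ℤ) =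
      MvPolynomial.coeff (exponents (2 * d) l r) (coeff (2 * d + l + r)
        (cWalkSeries (MvPolynomial.X 0 : MvPolynomial (Fin 3) ℤ)
          (MvPolynomial.X 1) (MvPolynomial.X 2))) := by
  classical
  have hmem (s : List ℤ) : s ∈ (walks (2 * d + l + r)).filter (fun s => IsCWalk s ∧
      pmOneSteps s = 2 * d ∧ lSteps s = l ∧ rSteps s = r) ↔
      IsCWalk s ∧ pmOneSteps s = 2 * d ∧ lSteps s = l ∧ rSteps s = r := by
    rw [Finset.mem_filter, mem_walks]
    refine ⟨And.right, fun h => ⟨⟨h.1.1, ?_⟩, h⟩⟩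
    rw [← pmOneSteps_add_lSteps_add_rSteps h.1.1, h.2.1, h.2.2.1, h.2.2.2]
  rw [Nat.subtype_card _ hmem, cWalkSeries, coeff_mk, MvPolynomial.coeff_sum,
    Finset.card_filter, Nat.cast_sum]
  refine Finset.sum_congr rfl fun s hs => ?_
  by_cases h : IsCWalk s
  · simp [h, walkWeight_eq _ _ _ h.1, coeff_exponents]
  · simp [h]

end BasketballWalk

/-- Refined count of C-walks by step statistics. -/
theorem stmt1 (d l r : ℕ) (hd : 1 ≤ d) :
    d * Nat.card {s : List ℤ //
        IsCWalk s ∧ pmOneSteps s = 2 * d ∧ lSteps s = l ∧ rSteps s = r} =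
      Nat.choose (2 * d - 2) (d - 1) * Nat.choose (l + r + 2 * d - 2) (l + r) *
        Nat.choose (l + r) l := by
  obtain ⟨k, rfl⟩ := Nat.exists_eq_add_of_le' hd
  have hcard : Nat.card {s : List ℤ //
      IsCWalk s ∧ pmOneSteps s = 2 * (k + 1) ∧ lSteps s = l ∧ rSteps s = r} =
      catalan k * ((2 * k + (l + r)).choose (2 * k) * (l + r).choose l) := by
    rw [← Nat.cast_inj (R := ℤ), BasketballWalk.card_cWalks, BasketballWalk.coeff_cWalkSeries,
      MvPolynomial.coeff_sum, Finset.sum_eq_single k]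
    · rw [if_pos (by omega), ← map_natCast (MvPolynomial.C (σ := Fin 3) (R := ℤ)),
        MvPolynomial.coeff_C_mul, mul_left_comm,
        ← map_natCast (MvPolynomial.C (σ := Fin 3) (R := ℤ)), MvPolynomial.coeff_C_mul,
        BasketballWalk.coeff_exponents_add_pow, if_pos (by omega)]
      rw [show 2 * (k + 1) + l + r - 2 = 2 * k + (l + r) by omega,
        show 2 * (k + 1) + l + r - (2 * k + 2) = l + r by omega]
      push_cast
      ring
    · intro j _ hj
      split_ifs with h
      · rw [← map_natCast (MvPolynomial.C (σ := Fin 3) (R := ℤ)),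
          MvPolynomial.coeff_C_mul, mul_left_comm,
          ← map_natCast (MvPolynomial.C (σ := Fin 3) (R := ℤ)), MvPolynomial.coeff_C_mul,
          BasketballWalk.coeff_exponents_add_pow, if_neg (by omega), mul_zero, mul_zero]
      · simp
    · simp
      omega
  rw [hcard, ← mul_assoc, succ_mul_catalan_eq_centralBinom, Nat.centralBinom_eq_two_mul_choose,
    show l + r + 2 * (k + 1) - 2 = 2 * k + (l + r) by omega, Nat.choose_symm_add, ← mul_assoc]
  rfl
end

section
/- For every integer n ≥ 0, the number of basketball walks of length n from 0 to 1 that are positive except at the origin is equal to the number of increasing unary-binary trees with n vertices whose associated permutation avoids the pattern 213. -/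
/-- A sequence (list) avoids the pattern 213. -/
def Avoids213 (s : List ℕ) : Prop :=
  ∀ i1 i2 i3, i1 < i2 → i2 < i3 → i3 < s.length →
    ¬ (s.getD i2 0 < s.getD i1 0 ∧ s.getD i1 0 < s.getD i3 0)
/-- Labeled unary-binary trees: each vertex carries a label and has 0, 1 or 2 children. -/
inductive UBTree where
  | lf : ℕ → UBTree
  | un : ℕ → UBTree → UBTree
  | bin : ℕ → UBTree → UBTree → UBTree

/-- Number of vertices. -/
def UBTree.size : UBTree → ℕ
  | .lf _ => 1
  | .un _ t => 1 + t.size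
  | .bin _ l r => 1 + l.size + r.size

/-- Root label. -/
def UBTree.label : UBTree → ℕ
  | .lf a => a
  | .un a _ => a
  | .bin a _ _ => a

/-- Ordered list of children (subtrees) of the root. -/
def UBTree.children : UBTree → List UBTree
  | .lf _ => []
  | .un _ t => [t]
  | .bin _ l r => [l, r]

/-- The labeling is increasing: every child has a larger label than its parent. -/
def UBTree.increasing : UBTree → Prop
  | .lf _ => True
  | .un a t => a < t.label ∧ t.increasing
  | .bin a l r => a < l.label ∧ a < r.label ∧ l.increasing ∧ r.increasing

/-- Number of unary nodes (vertices with exactly one child). -/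
def UBTree.unaryCount : UBTree → ℕ
  | .lf _ => 0
  | .un _ t => 1 + t.unaryCount
  | .bin _ l r => l.unaryCount + r.unaryCount

/-- Breadth-first traversal of a queue of trees, recording `f` at each vertex;
the fuel bounds the number of vertices processed. -/
def bfsAux (f : UBTree → ℕ) : ℕ → List UBTree → List ℕ
  | 0, _ => []
  | _ + 1, [] => []
  | n + 1, t :: ts => f t :: bfsAux f n (ts ++ t.children)

/-- Labels of the tree read in left-to-right breadth-first search order
(the fuel `t.size` is exactly the number of vertices, hence suffices). -/
def UBTree.bfs (t : UBTree) : List ℕ := bfsAux UBTree.label t.size [t]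

/-- Arities (numbers of children) of the vertices read in left-to-right
breadth-first search order. -/
def UBTree.bfsArity (t : UBTree) : List ℕ :=
  bfsAux (fun t => t.children.length) t.size [t]

/-- An increasing unary-binary tree (vertices labeled bijectively with `1, ..., n`,
children having larger labels than their parents) whose associated permutation
(labels in breadth-first search order) avoids the pattern 213. -/
def IsGoodUB (t : UBTree) : Prop :=
  t.increasing ∧ t.bfs.Perm (List.range' 1 t.size) ∧ Avoids213 t.bfs


section Levels

variable {σ R : Type*} [DecidableEq σ] [CommRing R]

/-- Objects reached from `s₀` after `n` expansions along `next`. -/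
def level (next : σ → Finset σ) (s₀ : σ) : ℕ → Finset σ
  | 0 => {s₀}
  | n + 1 => (level next s₀ n).biUnion next

theorem sum_level_succ {next : σ → Finset σ} (s₀ : σ) {pop : σ → σ}
    (hpop : ∀ s, ∀ s' ∈ next s, pop s' = s) (f : σ → R) (n : ℕ) :
    ∑ s ∈ level next s₀ (n + 1), f s = ∑ s ∈ level next s₀ n, ∑ s' ∈ next s, f s' := by
  refine Finset.sum_biUnion fun a _ b _ hab => ?_
  refine Finset.disjoint_left.2 fun s ha hb => hab ?_
  rw [← hpop a s ha, hpop b s hb]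

theorem level_expansion {next : σ → Finset σ} {s₀ : σ} {pop : σ → σ}
    (hpop : ∀ s, ∀ s' ∈ next s, pop s' = s) {S init : σ → R} {w : R}
    (hS : ∀ n, ∀ s ∈ level next s₀ n, S s = init s + w * ∑ s' ∈ next s, S s') (N : ℕ) :
    S s₀ = ∑ n ∈ Finset.range N, w ^ n * ∑ s ∈ level next s₀ n, init s +
      w ^ N * ∑ s ∈ level next s₀ N, S s := by
  induction N with
  | zero => simp [level]
  | succ N ih =>
    rw [ih, Finset.sum_range_succ, sum_level_succ s₀ hpop, Finset.sum_congr rfl (hS N),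
      Finset.sum_add_distrib, ← Finset.mul_sum]
    ring

theorem eq_of_expansion_eq {a b : ℕ → ℕ} {S w : PowerSeries ℚ}
    (hw : w ≠ 0) (hw0 : PowerSeries.constantCoeff w = 0)
    (ha : ∀ N, ∃ u, S = ∑ n ∈ Finset.range N, w ^ n * (a n : PowerSeries ℚ) + w ^ N * u)
    (hb : ∀ N, ∃ u, S = ∑ n ∈ Finset.range N, w ^ n * (b n : PowerSeries ℚ) + w ^ N * u) (n : ℕ) :
    a n = b n := by
  induction n using Nat.strong_induction_on with
  | _ n ih =>
    obtain ⟨u, hu⟩ := ha (n + 1)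
    obtain ⟨v, hv⟩ := hb (n + 1)
    have h := hu.symm.trans hv
    rw [Finset.sum_range_succ, Finset.sum_range_succ,
      Finset.sum_congr rfl fun m hm => by rw [ih m (Finset.mem_range.1 hm)]] at h
    have h2 : w ^ n * ((a n : PowerSeries ℚ) + w * u) =
        w ^ n * ((b n : PowerSeries ℚ) + w * v) := by
      linear_combination h
    have h3 := congrArg PowerSeries.constantCoeff (mul_left_cancel₀ (pow_ne_zero n hw) h2)
    simpa [hw0] using h3

end Levels

section Series

open PowerSeries

/-- The series `1 / (1 + X)`. -/
noncomputable def invOneAddX : PowerSeries ℚ := (1 + X)⁻¹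

/-- The series `X (1 + X) / (1 + X + X²)²`, substituted for the length variable. -/
noncomputable def lengthSeries : PowerSeries ℚ := X * (1 + X) * ((1 + X + X ^ 2)⁻¹) ^ 2

theorem invOneAddX_mul : invOneAddX * (1 + X) = 1 :=
  PowerSeries.inv_mul_cancel _ (by simp)

theorem lengthSeries_mul : lengthSeries * (1 + X + X ^ 2) ^ 2 = X * (1 + X) := by
  have h : ((1 + X + X ^ 2 : PowerSeries ℚ))⁻¹ * (1 + X + X ^ 2) = 1 :=
    PowerSeries.inv_mul_cancel _ (by simp)
  rw [lengthSeries, mul_assoc, ← mul_pow, h, one_pow, mul_one]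

theorem lengthSeries_ne_zero : lengthSeries ≠ 0 := by
  intro h
  have h2 := lengthSeries_mul
  rw [h, zero_mul] at h2
  exact mul_ne_zero X_ne_zero (right_ne_zero_of_mul_eq_one invOneAddX_mul) h2.symm

theorem constantCoeff_lengthSeries : constantCoeff lengthSeries = 0 := by
  simp [lengthSeries]

/-- Complete homogeneous polynomials in the two small roots of the basketball kernel. -/
noncomputable def kernelSeq : ℕ → PowerSeries ℚ
  | 0 => 1
  | 1 => X
  | n + 2 => X * kernelSeq (n + 1) + X * invOneAddX * kernelSeq n

/-- Series of positive basketball walks from height `j` to height `1`. -/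
noncomputable def walkSeries : ℕ → PowerSeries ℚ
  | 0 => X
  | j + 1 => (1 + X + X ^ 2) ^ 2 * invOneAddX ^ 2 * kernelSeq j

theorem lengthSeries_mul_walkSeries (j : ℕ) :
    lengthSeries * walkSeries (j + 1) = X * invOneAddX * kernelSeq j := by
  rw [walkSeries]
  linear_combination invOneAddX ^ 2 * kernelSeq j * lengthSeries_mul +
    X * invOneAddX * kernelSeq j * invOneAddX_mul

theorem walkSeries_zero :
    walkSeries 0 = lengthSeries * (walkSeries 1 + walkSeries 2) := by
  rw [mul_add, lengthSeries_mul_walkSeries, lengthSeries_mul_walkSeries]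
  simp only [walkSeries, kernelSeq]
  linear_combination -X * invOneAddX_mul

theorem walkSeries_one :
    walkSeries 1 = 1 + lengthSeries * (walkSeries 2 + walkSeries 3) := by
  rw [mul_add, lengthSeries_mul_walkSeries, lengthSeries_mul_walkSeries]
  simp only [walkSeries, kernelSeq]
  have := invOneAddX_mul
  generalize invOneAddX = r at *
  grind

theorem walkSeries_two :
    walkSeries 2 = lengthSeries * (walkSeries 1 + walkSeries 3 + walkSeries 4) := by
  rw [mul_add, mul_add, lengthSeries_mul_walkSeries, lengthSeries_mul_walkSeries,
    lengthSeries_mul_walkSeries]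
  simp only [walkSeries, kernelSeq]
  have := invOneAddX_mul
  generalize invOneAddX = r at *
  grind

theorem walkSeries_add_three (j : ℕ) :
    walkSeries (j + 3) = lengthSeries *
      (walkSeries (j + 1) + walkSeries (j + 2) + walkSeries (j + 4) + walkSeries (j + 5)) := by
  rw [mul_add, mul_add, mul_add, lengthSeries_mul_walkSeries, lengthSeries_mul_walkSeries,
    lengthSeries_mul_walkSeries, lengthSeries_mul_walkSeries]
  simp only [walkSeries, kernelSeq]
  have := invOneAddX_mul
  generalize invOneAddX = r at *
  generalize kernelSeq j = a
  generalize kernelSeq (j + 1) = b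
  grind

/-- Series of completions to a single tree of a good forest of `h` trees whose label word can be
extended on the left by `d` relative values. -/
noncomputable def forestSeries (h d : ℕ) : PowerSeries ℚ :=
  if h = 0 then X else X ^ (h - 1) * ((1 + X + X ^ 2) ^ 2 * invOneAddX) *
    ((1 + X + X ^ 2) * invOneAddX) ^ (d - 2)

theorem forestSeries_zero (d : ℕ) : forestSeries 0 d = lengthSeries * forestSeries 1 2 := by
  simp only [forestSeries, if_pos, one_ne_zero, if_false]
  linear_combination (-invOneAddX) * lengthSeries_mul - X * invOneAddX_mul

theorem lengthSeries_mul_geom_sum (d : ℕ) :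
    lengthSeries * X * ((1 + X + X ^ 2) * invOneAddX) ^ 2 *
      ∑ i ∈ Finset.range (d + 2), ((1 + X + X ^ 2) * invOneAddX) ^ i =
    ((1 + X + X ^ 2) * invOneAddX) ^ (d + 2) - 1 := by
  rw [← mul_geom_sum]
  congr 1
  have h1 := invOneAddX_mul
  have h2 := lengthSeries_mul
  generalize invOneAddX = r at *
  linear_combination X * r ^ 2 * h2 + (X ^ 2 * r - 1) * h1

theorem forestSeries_one (d : ℕ) :
    forestSeries 1 (d + 2) = 1 + lengthSeries *
      (∑ i ∈ Finset.range (d + 2), forestSeries 2 (i + 2) + forestSeries 1 2) := by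
  have hg := lengthSeries_mul_geom_sum d
  have h1 := invOneAddX_mul
  have h2 := lengthSeries_mul
  simp only [forestSeries, one_ne_zero, two_ne_zero, if_false, Nat.add_sub_cancel,
    ← Finset.mul_sum, Nat.sub_self, pow_zero, Nat.reduceSub, pow_one, mul_one, one_mul]
  rw [pow_add] at hg
  generalize ∑ i ∈ Finset.range (d + 2), ((1 + X + X ^ 2) * invOneAddX) ^ i = s at *
  generalize ((1 + X + X ^ 2) * invOneAddX) ^ d = c at *
  generalize invOneAddX = r at *
  linear_combination (-(1 + X)) * hg - r * h2 -
    ((1 + X + X ^ 2) ^ 2 * r * (c - lengthSeries * X * s) + X) * h1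

theorem forestSeries_add_two (h d : ℕ) :
    forestSeries (h + 2) (d + 2) = lengthSeries *
      (∑ i ∈ Finset.range (d + 2), forestSeries (h + 3) (i + 2) + forestSeries (h + 2) 2 +
        forestSeries (h + 1) 2) := by
  have hg := lengthSeries_mul_geom_sum d
  have h1 := invOneAddX_mul
  have h2 := lengthSeries_mul
  simp only [forestSeries, Nat.add_eq_zero_iff, one_ne_zero, OfNat.ofNat_ne_zero, and_false,
    if_false, Nat.add_sub_cancel, ← Finset.mul_sum, Nat.sub_self, pow_zero, mul_one,
    Nat.add_succ_sub_one]
  rw [pow_add] at hg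
  generalize ∑ i ∈ Finset.range (d + 2), ((1 + X + X ^ 2) * invOneAddX) ^ i = s at *
  generalize ((1 + X + X ^ 2) * invOneAddX) ^ d = c at *
  generalize invOneAddX = r at *
  linear_combination X ^ (h + 1) * (-(1 + X)) * hg - X ^ h * r * (1 + X) * h2 -
    X ^ (h + 1) * ((1 + X + X ^ 2) ^ 2 * r * (c - lengthSeries * X * s) + (1 + X)) * h1

end Series

section Walks

/-- One-step extensions of a walk that end at positive height. -/
def walkNext (s : List ℤ) : Finset (List ℤ) :=
  (({-2, -1, 1, 2} : Finset ℤ).filter fun x => 0 < s.sum + x).image fun x => s ++ [x]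

theorem mem_walkNext {s s' : List ℤ} :
    s' ∈ walkNext s ↔ ∃ x, (x = -2 ∨ x = -1 ∨ x = 1 ∨ x = 2) ∧ 0 < s.sum + x ∧ s ++ [x] = s' := by
  simp [walkNext, and_assoc]

theorem dropLast_of_mem_walkNext (s s' : List ℤ) (h : s' ∈ walkNext s) : s'.dropLast = s := by
  obtain ⟨x, -, -, rfl⟩ := mem_walkNext.1 h
  simp

theorem mem_level_walkNext {n : ℕ} {s : List ℤ} :
    s ∈ level walkNext [] n ↔
      s.length = n ∧ IsBasketball s ∧ ∀ i, 1 ≤ i → i ≤ s.length → 0 < ht s i := by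
  induction n generalizing s with
  | zero =>
    simp only [level, Finset.mem_singleton, List.length_eq_zero_iff]
    constructor
    · rintro rfl
      refine ⟨rfl, by simp [IsBasketball], fun i h1 h2 => ?_⟩
      simp at h2
      omega
    · exact fun h => h.1
  | succ n ih =>
    simp only [level, Finset.mem_biUnion, mem_walkNext, ih]
    constructor
    · rintro ⟨a, ⟨rfl, hb, hp⟩, x, hx, hpos, rfl⟩
      refine ⟨by simp, ?_, fun i h1 h2 => ?_⟩
      · intro y hy
        rcases List.mem_append.1 hy with hy | hy
        · exact hb y hy
        · rwa [List.mem_singleton.1 hy]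
      · rcases Nat.lt_or_ge a.length i with h | h
        · have hi : i = (a ++ [x]).length := by
            simp only [List.length_append, List.length_singleton] at h2 ⊢
            omega
          rw [ht, hi, List.take_length]
          simpa using hpos
        · simpa [ht, List.take_append_of_le_length h] using hp i h1 h
    · rintro ⟨hl, hb, hp⟩
      obtain ⟨a, x, rfl⟩ : ∃ a x, s = a ++ [x] := by
        have hne : s ≠ [] := by rintro rfl; simp at hl
        exact ⟨_, _, (List.dropLast_append_getLast hne).symm⟩
      refine ⟨a, ⟨by simpa using hl, fun y hy => hb y (by simp [hy]), fun i h1 h2 => ?_⟩, x,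
        hb x (by simp), ?_, rfl⟩
      · simpa [ht, List.take_append_of_le_length h2] using hp i h1 (by simp; omega)
      · simpa [ht] using hp (a.length + 1) (by omega) (by simp)

theorem sum_nonneg_of_mem_level {n : ℕ} {s : List ℤ} (h : s ∈ level walkNext [] n) :
    0 ≤ s.sum := by
  obtain ⟨-, -, hp⟩ := mem_level_walkNext.1 h
  rcases Nat.eq_zero_or_pos s.length with h0 | h0
  · simp [List.length_eq_zero_iff.1 h0]
  · simpa [ht] using (hp s.length h0 le_rfl).le

theorem walkSeries_sum_next {s : List ℤ} (hs : 0 ≤ s.sum) :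
    walkSeries s.sum.toNat = ((if s.sum = 1 then 1 else 0 : ℕ) : PowerSeries ℚ) +
      lengthSeries * ∑ s' ∈ walkNext s, walkSeries s'.sum.toNat := by
  have hinj : Function.Injective fun x : ℤ => s ++ [x] := fun x y h => by simpa using h
  obtain ⟨k, hk⟩ := Int.eq_ofNat_of_zero_le hs
  rw [walkNext, Finset.sum_image hinj.injOn, Finset.sum_filter]
  simp only [List.sum_append, List.sum_singleton, hk]
  rw [Finset.sum_insert (by simp), Finset.sum_insert (by simp), Finset.sum_insert (by simp),
    Finset.sum_singleton]
  match k with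
  | 0 => simpa using walkSeries_zero
  | 1 => simpa using walkSeries_one
  | 2 => simpa [add_assoc] using walkSeries_two
  | j + 3 =>
    have h1 : ((j + 3 : ℕ) : ℤ) + -2 = (j + 1 : ℕ) := by push_cast; ring
    have h2 : ((j + 3 : ℕ) : ℤ) + -1 = (j + 2 : ℕ) := by push_cast; ring
    have h3 : ((j + 3 : ℕ) : ℤ) + 1 = (j + 4 : ℕ) := by push_cast; ring
    have h4 : ((j + 3 : ℕ) : ℤ) + 2 = (j + 5 : ℕ) := by push_cast; ring
    rw [h1, h2, h3, h4, if_neg (by omega), if_pos (by omega), if_pos (by omega),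
      if_pos (by omega), if_pos (by omega)]
    simp only [Int.toNat_natCast]
    simpa [add_assoc, show (j : ℤ) + 3 ≠ 1 by omega] using walkSeries_add_three j

theorem card_gWalk (n : ℕ) :
    Nat.card {s : List ℤ // IsGWalk s ∧ s.length = n} =
      ((level walkNext [] n).filter fun s => s.sum = 1).card := by
  rw [← Nat.card_eq_finsetCard]
  refine Nat.card_congr (Equiv.subtypeEquivRight fun s => ?_)
  rw [Finset.mem_filter, mem_level_walkNext]
  simp only [IsGWalk, ht, List.take_length]
  tauto

end Walks

section Words

/-- Order-preserving relabeling that frees the value `v`. -/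
def shift (v x : ℕ) : ℕ := if x < v then x else x + 1

/-- Left inverse of `shift v`. -/
def unshift (v x : ℕ) : ℕ := if x < v then x else x - 1

theorem unshift_shift (v x : ℕ) : unshift v (shift v x) = x := by
  unfold unshift shift; split_ifs <;> omega

theorem shift_unshift {v x : ℕ} (h : x ≠ v) : shift v (unshift v x) = x := by
  unfold unshift shift; split_ifs <;> omega

theorem shift_strictMono (v : ℕ) : StrictMono (shift v) := by
  intro x y h; unfold shift; split_ifs <;> omega

theorem shift_ne (v x : ℕ) : shift v x ≠ v := by
  unfold shift; split_ifs <;> omega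

theorem shift_lt_iff {v x : ℕ} : shift v x < v ↔ x < v := by
  unfold shift; split_ifs <;> omega

theorem lt_shift_iff {v x : ℕ} : v < shift v x ↔ v ≤ x := by
  unfold shift; split_ifs <;> omega

/-- Recursive form of 213-avoidance. -/
def Avoiding : List ℕ → Prop
  | [] => True
  | v :: l => (l.Pairwise fun x y => ¬(x < v ∧ v < y)) ∧ Avoiding l

theorem avoids213_iff_avoiding (l : List ℕ) : Avoids213 l ↔ Avoiding l := by
  induction l with
  | nil => simp [Avoids213, Avoiding]
  | cons v l ih =>
    rw [Avoiding, ← ih, List.pairwise_iff_getElem]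
    constructor
    · intro h
      refine ⟨fun i j hi hj hij => ?_, fun i1 i2 i3 h1 h2 h3 => ?_⟩
      · simpa [List.getD_cons_succ, hi, hj] using
          h 0 (i + 1) (j + 1) (by omega) (by omega) (by simpa using hj)
      · simpa using h (i1 + 1) (i2 + 1) (i3 + 1) (by omega) (by omega) (by simpa using h3)
    · rintro ⟨hv, hl⟩ i1 i2 i3 h1 h2 h3
      obtain ⟨j2, rfl⟩ : ∃ j, i2 = j + 1 := ⟨i2 - 1, by omega⟩
      obtain ⟨j3, rfl⟩ : ∃ j, i3 = j + 1 := ⟨i3 - 1, by omega⟩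
      rw [List.length_cons] at h3
      rcases i1 with _ | i1
      · have h4 : j2 < l.length := by omega
        have h5 : j3 < l.length := by omega
        simpa [h4, h5] using hv j2 j3 h4 h5 (by omega)
      · simpa using hl i1 j2 j3 (by omega) (by omega) (by omega)

theorem avoiding_map {f : ℕ → ℕ} (hf : StrictMono f) (l : List ℕ) :
    Avoiding (l.map f) ↔ Avoiding l := by
  induction l with
  | nil => rfl
  | cons v l ih => simp only [List.map_cons, Avoiding, ih, List.pairwise_map, hf.lt_iff_lt]

/-- The word may be extended on the left by the relative value `v` without creating a
213 pattern. -/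
def Extends (v : ℕ) (l : List ℕ) : Prop := l.Pairwise fun x y => ¬(x < v ∧ v ≤ y)

theorem avoiding_cons_shift (v : ℕ) (l : List ℕ) :
    Avoiding (v :: l.map (shift v)) ↔ Avoiding l ∧ Extends v l := by
  rw [Avoiding, avoiding_map (shift_strictMono v), List.pairwise_map, Extends, and_comm]
  simp only [shift_lt_iff, lt_shift_iff]

/-- The word is a permutation of `1, ..., n`, where `n` is its length. -/
def IsStandard (l : List ℕ) : Prop := l.Nodup ∧ ∀ x, x ∈ l ↔ 1 ≤ x ∧ x ≤ l.length

theorem perm_range'_iff_isStandard (l : List ℕ) :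
    l.Perm (List.range' 1 l.length) ↔ IsStandard l := by
  have hm : ∀ x, x ∈ List.range' 1 l.length ↔ 1 ≤ x ∧ x ≤ l.length := fun x => by
    rw [List.mem_range'_1]; omega
  constructor
  · exact fun h => ⟨h.nodup_iff.2 List.nodup_range', fun x => h.mem_iff.trans (hm x)⟩
  · exact fun h => (List.perm_ext_iff_of_nodup h.1 List.nodup_range').2 fun x =>
      (h.2 x).trans (hm x).symm

theorem isStandard_cons_shift (v : ℕ) (l : List ℕ) :
    IsStandard (v :: l.map (shift v)) ↔ IsStandard l ∧ 1 ≤ v ∧ v ≤ l.length + 1 := by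
  have hinj := (shift_strictMono v).injective
  have hv : v ∉ l.map (shift v) := by
    rw [List.mem_map]; rintro ⟨x, -, h⟩; exact shift_ne v x h
  simp only [IsStandard, List.nodup_cons, List.nodup_map_iff hinj, List.length_cons,
    List.length_map, List.mem_cons]
  constructor
  · rintro ⟨⟨-, hn⟩, hm⟩
    have h1 := (hm v).1 (Or.inl rfl)
    refine ⟨⟨hn, fun x => ?_⟩, h1⟩
    rw [← List.mem_map_of_injective hinj]
    have h2 := hm (shift v x)
    rw [or_iff_right (shift_ne v x)] at h2
    rw [h2]
    unfold shift; split_ifs <;> omega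
  · rintro ⟨⟨hn, hm⟩, h1⟩
    refine ⟨⟨hv, hn⟩, fun y => ?_⟩
    by_cases hy : y = v
    · simpa [hy] using h1
    · rw [or_iff_right hy]
      nth_rewrite 1 [← shift_unshift hy]
      rw [List.mem_map_of_injective hinj, hm]
      unfold unshift; split_ifs <;> omega

open Classical in
/-- Relative values by which the word may be extended on the left. -/
noncomputable def extensions (l : List ℕ) : Finset ℕ :=
  (Finset.Icc 1 (l.length + 1)).filter fun v => Extends v l

theorem mem_extensions {l : List ℕ} {v : ℕ} :
    v ∈ extensions l ↔ (1 ≤ v ∧ v ≤ l.length + 1) ∧ Extends v l := by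
  simp [extensions]

theorem one_mem_extensions {l : List ℕ} (hl : IsStandard l) : 1 ∈ extensions l := by
  refine mem_extensions.2 ⟨by omega, List.pairwise_of_forall_mem_list fun x hx y _ => ?_⟩
  have := (hl.2 x).1 hx
  omega

theorem length_add_one_mem_extensions {l : List ℕ} (hl : IsStandard l) :
    l.length + 1 ∈ extensions l := by
  refine mem_extensions.2 ⟨by omega, List.pairwise_of_forall_mem_list fun x _ y hy => ?_⟩
  have := (hl.2 y).1 hy
  omega

theorem extensions_cons_shift {l : List ℕ} {v : ℕ} (hl : IsStandard l) (hv : v ∈ extensions l) :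
    extensions (v :: l.map (shift v)) =
      insert (l.length + 2) ((extensions l).filter fun w => w ≤ v) := by
  obtain ⟨hv1, -⟩ := mem_extensions.1 hv
  have hs := (isStandard_cons_shift v l).2 ⟨hl, hv1⟩
  ext w
  rw [Finset.mem_insert, Finset.mem_filter]
  constructor
  · intro hw
    obtain ⟨hw1, hw2⟩ := mem_extensions.1 hw
    rw [Extends, List.pairwise_cons, List.pairwise_map] at hw2
    simp only [List.length_cons, List.length_map] at hw1
    by_cases hwl : w = l.length + 2
    · exact Or.inl hwl
    have hwv : w ≤ v := by
      by_contra h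
      have hm := (hs.2 w).2 (by simp; omega)
      rcases List.mem_cons.1 hm with hm | hm
      · omega
      · exact hw2.1 w hm ⟨by omega, le_rfl⟩
    refine Or.inr ⟨mem_extensions.2 ⟨by omega, hw2.2.imp fun {x y} h h' => h ?_⟩, hwv⟩
    unfold shift; split_ifs <;> omega
  · rintro (rfl | ⟨hw, hwv⟩)
    · simpa using length_add_one_mem_extensions hs
    · obtain ⟨hw1, hw2⟩ := mem_extensions.1 hw
      refine mem_extensions.2 ⟨by simp; omega, ?_⟩
      rw [Extends, List.pairwise_cons, List.pairwise_map]
      refine ⟨fun y _ => by omega, hw2.imp fun {x y} h h' => h ?_⟩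
      unfold shift at h'; split_ifs at h' <;> omega

theorem card_extensions_cons_shift {l : List ℕ} {v : ℕ} (hl : IsStandard l)
    (hv : v ∈ extensions l) :
    (extensions (v :: l.map (shift v))).card =
      ((extensions l).filter fun w => w ≤ v).card + 1 := by
  rw [extensions_cons_shift hl hv, Finset.card_insert_of_notMem]
  rw [Finset.mem_filter, mem_extensions]
  omega

theorem card_extensions_cons_shift_one {l : List ℕ} (hl : IsStandard l) :
    (extensions (1 :: l.map (shift 1))).card = 2 := by
  rw [card_extensions_cons_shift hl (one_mem_extensions hl)]
  suffices (extensions l).filter (fun w => w ≤ 1) = {1} by rw [this]; rfl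
  ext w
  rw [Finset.mem_filter, Finset.mem_singleton]
  constructor
  · rintro ⟨h, h1⟩
    have := (mem_extensions.1 h).1
    omega
  · rintro rfl
    exact ⟨one_mem_extensions hl, le_rfl⟩

theorem two_le_card_extensions {l : List ℕ} (hl : IsStandard l) (hne : l ≠ []) :
    2 ≤ (extensions l).card := by
  have h0 := List.length_pos_iff.2 hne
  rw [← Finset.card_pair (show 1 ≠ l.length + 1 by omega)]
  refine Finset.card_le_card ?_
  simp [Finset.insert_subset_iff, one_mem_extensions hl, length_add_one_mem_extensions hl]

theorem sum_card_filter_le {R : Type*} [AddCommMonoid R] (D : Finset ℕ) (f : ℕ → R) :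
    ∑ v ∈ D, f ((D.filter fun w => w ≤ v).card) = ∑ i ∈ Finset.range D.card, f (i + 1) := by
  induction D using Finset.induction_on_max with
  | empty => simp
  | insert a s ha ih =>
    have hn : a ∉ s := fun h => (ha a h).false
    rw [Finset.sum_insert hn, Finset.card_insert_of_notMem hn, Finset.sum_range_succ, ← ih,
      add_comm]
    congr 1
    · refine Finset.sum_congr rfl fun v hv => ?_
      rw [Finset.filter_insert, if_neg (not_le.2 (ha v hv))]
    · rw [Finset.filter_true_of_mem, Finset.card_insert_of_notMem hn]
      intro w hw
      rcases Finset.mem_insert.1 hw with rfl | hw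
      · exact le_rfl
      · exact (ha w hw).le

end Words

section Forests

noncomputable instance : DecidableEq UBTree := Classical.decEq _

/-- Relabeling of a tree. -/
def UBTree.map (f : ℕ → ℕ) : UBTree → UBTree
  | .lf a => .lf (f a)
  | .un a t => .un (f a) (t.map f)
  | .bin a l r => .bin (f a) (l.map f) (r.map f)

@[simp] theorem UBTree.label_map (f : ℕ → ℕ) (t : UBTree) : (t.map f).label = f t.label := by
  cases t <;> rfl

@[simp] theorem UBTree.children_map (f : ℕ → ℕ) (t : UBTree) :
    (t.map f).children = t.children.map (UBTree.map f) := by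
  cases t <;> rfl

theorem UBTree.map_map (f g : ℕ → ℕ) (t : UBTree) : (t.map f).map g = t.map (g ∘ f) := by
  induction t <;> simp_all [UBTree.map]

theorem UBTree.map_id' {f : ℕ → ℕ} (hf : ∀ x, f x = x) (t : UBTree) : t.map f = t := by
  induction t <;> simp_all [UBTree.map]

theorem UBTree.increasing_map {f : ℕ → ℕ} (hf : StrictMono f) (t : UBTree) :
    (t.map f).increasing ↔ t.increasing := by
  induction t <;> simp_all [UBTree.map, UBTree.increasing, hf.lt_iff_lt]

theorem UBTree.increasing_iff (t : UBTree) :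
    t.increasing ↔ ∀ c ∈ t.children, t.label < c.label ∧ c.increasing := by
  cases t <;> simp [UBTree.increasing, UBTree.children, UBTree.label]
  tauto

theorem UBTree.eq_of_label_children {t u : UBTree} (hl : t.label = u.label)
    (hc : t.children = u.children) : t = u := by
  cases t <;> cases u <;> simp_all [UBTree.label, UBTree.children]

/-- Total number of vertices of a list of trees. -/
def forestSize (Q : List UBTree) : ℕ := (Q.map UBTree.size).sum

/-- Labels of a list of trees in breadth-first order. -/
def forestWord (Q : List UBTree) : List ℕ := bfsAux UBTree.label (forestSize Q) Q

theorem forestSize_cons (t : UBTree) (ts : List UBTree) :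
    forestSize (t :: ts) = forestSize (ts ++ t.children) + 1 := by
  cases t <;> simp [forestSize, UBTree.size, UBTree.children] <;> ring

theorem forestWord_cons (t : UBTree) (ts : List UBTree) :
    forestWord (t :: ts) = t.label :: forestWord (ts ++ t.children) := by
  rw [forestWord, forestSize_cons, bfsAux, forestWord]

theorem forest_induction {P : List UBTree → Prop} (nil : P [])
    (cons : ∀ t ts, P (ts ++ t.children) → P (t :: ts)) (Q : List UBTree) : P Q := by
  induction h : forestSize Q generalizing Q with
  | zero =>
    cases Q with
    | nil => exact nil
    | cons t ts => rw [forestSize_cons] at h; omega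
  | succ n ih =>
    cases Q with
    | nil => exact nil
    | cons t ts => exact cons t ts (ih _ (by rw [forestSize_cons] at h; omega))

theorem length_forestWord (Q : List UBTree) : (forestWord Q).length = forestSize Q := by
  induction Q using forest_induction with
  | nil => rfl
  | cons t ts ih => rw [forestWord_cons, forestSize_cons, List.length_cons, ih]

theorem forestWord_map (f : ℕ → ℕ) (Q : List UBTree) :
    forestWord (Q.map (UBTree.map f)) = (forestWord Q).map f := by
  induction Q using forest_induction with
  | nil => rfl
  | cons t ts ih =>
    rw [List.map_cons, forestWord_cons, forestWord_cons, List.map_cons, ← ih]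
    simp

theorem map_label_prefix_forestWord (Q : List UBTree) :
    Q.map UBTree.label <+: forestWord Q := by
  induction Q using forest_induction with
  | nil => exact List.prefix_rfl
  | cons t ts ih =>
    rw [List.map_cons, forestWord_cons, List.prefix_cons_inj]
    rw [List.map_append] at ih
    exact (List.prefix_append _ _).trans ih

theorem exists_label_le_of_mem_forestWord {Q : List UBTree} (hQ : ∀ t ∈ Q, t.increasing) {x : ℕ}
    (hx : x ∈ forestWord Q) : ∃ t ∈ Q, t.label ≤ x := by
  induction Q using forest_induction with
  | nil => simp [forestWord, forestSize, bfsAux] at hx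
  | cons t ts ih =>
    have ht := (UBTree.increasing_iff t).1 (hQ t (by simp))
    rw [forestWord_cons, List.mem_cons] at hx
    rcases hx with rfl | hx
    · exact ⟨t, by simp⟩
    obtain ⟨u, hu, hux⟩ := ih (fun u hu => (List.mem_append.1 hu).elim
      (fun h => hQ u (by simp [h])) (fun h => (ht u h).2)) hx
    rcases List.mem_append.1 hu with h | h
    · exact ⟨u, by simp [h], hux⟩
    · exact ⟨t, by simp, (ht u h).1.le.trans hux⟩

theorem map_eq_self_of_forestWord {f : ℕ → ℕ} {Q : List UBTree}
    (h : ∀ x ∈ forestWord Q, f x = x) : Q.map (UBTree.map f) = Q := by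
  induction Q using forest_induction with
  | nil => rfl
  | cons t ts ih =>
    simp only [forestWord_cons, List.mem_cons, forall_eq_or_imp] at h
    have h2 := ih h.2
    rw [List.map_append] at h2
    obtain ⟨h3, h4⟩ := List.append_inj h2 (by simp)
    rw [List.map_cons, h3, UBTree.eq_of_label_children (t := t.map f) (u := t)]
    · rw [UBTree.label_map, h.1]
    · rw [UBTree.children_map, h4]

/-- Lists of increasing trees whose breadth-first word is a 213-avoiding permutation. -/
def GoodForest (Q : List UBTree) : Prop :=
  (∀ t ∈ Q, t.increasing) ∧ IsStandard (forestWord Q) ∧ Avoiding (forestWord Q)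

theorem label_lt_of_mem_forestWord {t : UBTree} {ts : List UBTree} (h : GoodForest (t :: ts))
    (hc : t.children ≠ []) {x : ℕ} (hx : x ∈ forestWord (ts ++ t.children)) : t.label < x := by
  obtain ⟨hi, hs, ha⟩ := h
  rw [forestWord_cons] at hs ha
  have ht := (UBTree.increasing_iff t).1 (hi t (by simp))
  obtain ⟨u, hu, hux⟩ := exists_label_le_of_mem_forestWord (fun u hu => (List.mem_append.1 hu).elim
    (fun h => hi u (by simp [h])) (fun h => (ht u h).2)) hx
  have hne : t.label ≠ x := fun h => (List.nodup_cons.1 hs.1).1 (h ▸ hx)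
  suffices t.label ≤ u.label by omega
  rcases List.mem_append.1 hu with h | h
  · obtain ⟨c, hcm⟩ := List.exists_mem_of_ne_nil _ hc
    have hp := ha.1.sublist (map_label_prefix_forestWord (ts ++ t.children)).sublist
    rw [List.map_append, List.pairwise_append] at hp
    have := hp.2.2 _ (List.mem_map_of_mem h) _ (List.mem_map_of_mem hcm)
    have := (ht c hcm).1
    omega
  · exact (ht u h).1.le

theorem goodForest_cons {t : UBTree} {ts Q : List UBTree}
    (h : ts ++ t.children = Q.map (UBTree.map (shift t.label))) :
    GoodForest (t :: ts) ↔
      GoodForest Q ∧ t.label ∈ extensions (forestWord Q) ∧ (t.children ≠ [] → t.label = 1) := by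
  have hw : forestWord (t :: ts) = t.label :: (forestWord Q).map (shift t.label) := by
    rw [forestWord_cons, h, forestWord_map]
  have hinc : (∀ u ∈ ts ++ t.children, u.increasing) ↔ ∀ u ∈ Q, u.increasing := by
    rw [h]
    simp [UBTree.increasing_map (shift_strictMono _)]
  have hst : IsStandard (forestWord (t :: ts)) ↔
      IsStandard (forestWord Q) ∧ 1 ≤ t.label ∧ t.label ≤ (forestWord Q).length + 1 := by
    rw [hw, isStandard_cons_shift]
  have hav : Avoiding (forestWord (t :: ts)) ↔
      Avoiding (forestWord Q) ∧ Extends t.label (forestWord Q) := by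
    rw [hw, avoiding_cons_shift]
  rw [mem_extensions]
  constructor
  · intro hg
    have ⟨hi, hs, ha⟩ := hg
    have hti := (UBTree.increasing_iff t).1 (hi t (by simp))
    refine ⟨⟨hinc.1 fun u hu => ?_, (hst.1 hs).1, (hav.1 ha).1⟩, ⟨(hst.1 hs).2, (hav.1 ha).2⟩,
      fun hc => ?_⟩
    · rcases List.mem_append.1 hu with h | h
      · exact hi u (by simp [h])
      · exact (hti u h).2
    · have h1 := (hs.2 1).2 ⟨le_rfl, by rw [hw]; simp⟩
      rw [forestWord_cons, List.mem_cons] at h1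
      rcases h1 with h1 | h1
      · exact h1.symm
      · have := label_lt_of_mem_forestWord hg hc h1
        have := (hst.1 hs).2.1
        omega
  · rintro ⟨⟨hi, hs, ha⟩, ⟨hv, he⟩, h1⟩
    refine ⟨fun u hu => ?_, hst.2 ⟨hs, hv⟩, hav.2 ⟨ha, he⟩⟩
    rcases List.mem_cons.1 hu with rfl | hu
    · rw [UBTree.increasing_iff]
      intro c hc
      have hcm : c ∈ ts ++ u.children := by simp [hc]
      refine ⟨?_, hinc.2 hi c hcm⟩
      rw [h, List.mem_map] at hcm
      obtain ⟨d, hd, rfl⟩ := hcm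
      rw [UBTree.label_map, lt_shift_iff, h1 (List.ne_nil_of_mem hc)]
      exact ((hs.2 _).1 ((map_label_prefix_forestWord Q).subset (List.mem_map_of_mem hd))).1
    · exact hinc.2 hi u (by simp [hu])

/-- Removal of the first vertex in breadth-first order. -/
def forestPop : List UBTree → List UBTree
  | [] => []
  | t :: ts => (ts ++ t.children).map (UBTree.map (unshift t.label))

/-- Ways of putting in front of a list of trees a vertex labeled `1` that adopts the last tree or
the last two trees. -/
noncomputable def graft (R : List UBTree) : Finset (List UBTree) :=
  match R.reverse with
  | [] => ∅
  | [c] => {[.un 1 c]}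
  | d :: c :: r => {.un 1 d :: (r.reverse ++ [c]), .bin 1 c d :: r.reverse}

theorem mem_graft {R F : List UBTree} :
    F ∈ graft R ↔
      ∃ t ts, F = t :: ts ∧ t.label = 1 ∧ t.children ≠ [] ∧ ts ++ t.children = R := by
  constructor
  · intro h
    unfold graft at h
    split at h
    · simp at h
    · next c hR =>
      rw [List.reverse_eq_iff] at hR
      exact ⟨.un 1 c, [], by simpa using h, rfl, by simp [UBTree.children],
        by simp [UBTree.children, hR]⟩
    · next d c r hR =>
      rw [List.reverse_eq_iff] at hR
      rw [Finset.mem_insert, Finset.mem_singleton] at h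
      rcases h with rfl | rfl
      · exact ⟨_, _, rfl, rfl, by simp [UBTree.children], by simp [UBTree.children, hR]⟩
      · exact ⟨_, _, rfl, rfl, by simp [UBTree.children], by simp [UBTree.children, hR]⟩
  · rintro ⟨t, ts, rfl, h1, hc, rfl⟩
    unfold graft
    cases t with
    | lf a => simp [UBTree.children] at hc
    | un a c =>
      obtain rfl : a = 1 := h1
      rcases List.eq_nil_or_concat ts with rfl | ⟨ts, b, rfl⟩ <;> simp [UBTree.children]
    | bin a c d =>
      obtain rfl : a = 1 := h1
      simp [UBTree.children]

/-- Lists of trees obtained by adding a new first vertex in breadth-first order. -/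
noncomputable def forestNext (Q : List UBTree) : Finset (List UBTree) :=
  (extensions (forestWord Q)).image (fun v => .lf v :: Q.map (UBTree.map (shift v))) ∪
    graft (Q.map (UBTree.map (shift 1)))

theorem mem_forestNext {Q F : List UBTree} (hQ : GoodForest Q) :
    F ∈ forestNext Q ↔ ∃ t ts, F = t :: ts ∧
      ts ++ t.children = Q.map (UBTree.map (shift t.label)) ∧
      t.label ∈ extensions (forestWord Q) ∧ (t.children ≠ [] → t.label = 1) := by
  rw [forestNext, Finset.mem_union, Finset.mem_image, mem_graft]
  constructor
  · rintro (⟨v, hv, rfl⟩ | ⟨t, ts, rfl, h1, hc, h⟩)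
    · exact ⟨_, _, rfl, by simp [UBTree.children, UBTree.label], hv, by simp [UBTree.children]⟩
    · exact ⟨t, ts, rfl, by rw [h1, h], h1 ▸ one_mem_extensions hQ.2.1, fun _ => h1⟩
  · rintro ⟨t, ts, rfl, h, hv, h1⟩
    by_cases hc : t.children = []
    · refine Or.inl ⟨t.label, hv, ?_⟩
      rw [← h, hc, List.append_nil]
      cases t <;> simp_all [UBTree.children, UBTree.label]
    · exact Or.inr ⟨t, ts, rfl, h1 hc, hc, by rw [h, h1 hc]⟩

theorem map_unshift_map_shift (v : ℕ) (Q : List UBTree) :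
    (Q.map (UBTree.map (shift v))).map (UBTree.map (unshift v)) = Q := by
  rw [List.map_map]
  refine (List.map_congr_left fun t _ => ?_).trans (List.map_id Q)
  rw [Function.comp_apply, UBTree.map_map,
    UBTree.map_id' (f := unshift v ∘ shift v) (unshift_shift v), id]

theorem forestPop_of_mem_forestNext (Q F : List UBTree) (h : F ∈ forestNext Q) :
    forestPop F = Q := by
  rw [forestNext, Finset.mem_union, Finset.mem_image, mem_graft] at h
  rcases h with ⟨v, -, rfl⟩ | ⟨t, ts, rfl, h1, -, h⟩
  · simpa [forestPop, UBTree.children, UBTree.label] using map_unshift_map_shift v Q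
  · rw [forestPop, h, h1, map_unshift_map_shift]

theorem mem_level_forestNext {n : ℕ} {F : List UBTree} :
    F ∈ level forestNext [] n ↔ forestSize F = n ∧ GoodForest F := by
  induction n generalizing F with
  | zero =>
    rw [level, Finset.mem_singleton]
    constructor
    · rintro rfl
      exact ⟨rfl, by simp, by simp [IsStandard, forestWord, forestSize, bfsAux]; omega, trivial⟩
    · rintro ⟨h, -⟩
      cases F with
      | nil => rfl
      | cons t ts => rw [forestSize_cons] at h; omega
  | succ n ih =>
    rw [level, Finset.mem_biUnion]
    constructor
    · rintro ⟨Q, hQ, hF⟩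
      obtain ⟨hn, hg⟩ := ih.1 hQ
      obtain ⟨t, ts, rfl, h, hF⟩ := (mem_forestNext hg).1 hF
      refine ⟨?_, (goodForest_cons h).2 ⟨hg, hF⟩⟩
      rw [forestSize_cons, h, ← length_forestWord, forestWord_map, List.length_map,
        length_forestWord, hn]
    · rintro ⟨hn, hg⟩
      cases F with
      | nil => simp [forestSize] at hn
      | cons t ts =>
        have hs := hg.2.1.1
        rw [forestWord_cons, List.nodup_cons] at hs
        have h : ts ++ t.children = (forestPop (t :: ts)).map (UBTree.map (shift t.label)) := by
          rw [forestPop, List.map_map, show UBTree.map (shift t.label) ∘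
            UBTree.map (unshift t.label) = UBTree.map (shift t.label ∘ unshift t.label) from
            funext fun u => UBTree.map_map _ _ u]
          exact (map_eq_self_of_forestWord fun x hx => shift_unshift
            fun hxt : x = t.label => hs.1 (hxt ▸ hx)).symm
        have hg2 := (goodForest_cons h).1 hg
        refine ⟨_, ih.2 ⟨?_, hg2.1⟩, (mem_forestNext hg2.1).2 ⟨t, ts, rfl, h, hg2.2⟩⟩
        rw [forestPop, ← length_forestWord, forestWord_map, List.length_map, length_forestWord]
        rw [forestSize_cons] at hn
        omega

/-- The completion series of a list of trees. -/
noncomputable def forestWeight (Q : List UBTree) : PowerSeries ℚ :=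
  forestSeries Q.length (extensions (forestWord Q)).card

theorem sum_forestWeight_leaf {Q : List UBTree} (hQ : GoodForest Q) :
    ∑ v ∈ extensions (forestWord Q), forestWeight (.lf v :: Q.map (UBTree.map (shift v))) =
      ∑ i ∈ Finset.range (extensions (forestWord Q)).card,
        forestSeries (Q.length + 1) (i + 2) := by
  rw [← sum_card_filter_le (extensions (forestWord Q))
    fun i => forestSeries (Q.length + 1) (i + 1)]
  refine Finset.sum_congr rfl fun v hv => ?_
  rw [forestWeight, forestWord_cons, UBTree.children, List.append_nil, forestWord_map,
    UBTree.label, card_extensions_cons_shift hQ.2.1 hv, List.length_cons, List.length_map]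

theorem forestWeight_graft {Q ts : List UBTree} {t : UBTree} (hQ : GoodForest Q)
    (h1 : t.label = 1) (h : ts ++ t.children = Q.map (UBTree.map (shift 1))) :
    forestWeight (t :: ts) = forestSeries (ts.length + 1) 2 := by
  rw [forestWeight, forestWord_cons, h, forestWord_map, h1,
    card_extensions_cons_shift_one hQ.2.1, List.length_cons]

theorem sum_forestWeight_graft {Q : List UBTree} (hQ : GoodForest Q) :
    ∑ F ∈ graft (Q.map (UBTree.map (shift 1))), forestWeight F =
      (if 1 ≤ Q.length then forestSeries Q.length 2 else 0) +
        if 2 ≤ Q.length then forestSeries (Q.length - 1) 2 else 0 := by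
  have hlen : (Q.map (UBTree.map (shift 1))).length = Q.length := by simp
  unfold graft
  split
  · next hR =>
    rw [List.reverse_eq_iff] at hR
    rw [← hlen, hR]
    simp
  · next c hR =>
    rw [List.reverse_eq_iff] at hR
    rw [Finset.sum_singleton, forestWeight_graft hQ rfl (by simp [hR, UBTree.children]), ← hlen,
      hR]
    simp
  · next d c r hR =>
    rw [List.reverse_eq_iff] at hR
    rw [Finset.sum_pair (by simp), forestWeight_graft hQ rfl (by simp [hR, UBTree.children]),
      forestWeight_graft hQ rfl (by simp [hR, UBTree.children]), ← hlen, hR]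
    simp

theorem forestWeight_expand {Q : List UBTree} (hQ : GoodForest Q) :
    forestWeight Q = ((if Q.length = 1 then 1 else 0 : ℕ) : PowerSeries ℚ) +
      lengthSeries * ∑ F ∈ forestNext Q, forestWeight F := by
  have hd : Disjoint ((extensions (forestWord Q)).image
      (fun v => UBTree.lf v :: Q.map (UBTree.map (shift v))))
      (graft (Q.map (UBTree.map (shift 1)))) := by
    refine Finset.disjoint_left.2 fun F hF hF2 => ?_
    obtain ⟨v, -, rfl⟩ := Finset.mem_image.1 hF
    obtain ⟨t, ts, h, -, hc, -⟩ := mem_graft.1 hF2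
    rw [← (List.cons.inj h).1] at hc
    exact hc rfl
  have hinj : Function.Injective fun v => UBTree.lf v :: Q.map (UBTree.map (shift v)) := by
    intro v w h
    simpa using (List.cons.inj h).1
  have hsum : ∑ F ∈ forestNext Q, forestWeight F =
      ∑ i ∈ Finset.range (extensions (forestWord Q)).card,
        forestSeries (Q.length + 1) (i + 2) +
      ((if 1 ≤ Q.length then forestSeries Q.length 2 else 0) +
        if 2 ≤ Q.length then forestSeries (Q.length - 1) 2 else 0) := by
    rw [← sum_forestWeight_leaf hQ, ← sum_forestWeight_graft hQ,
      ← Finset.sum_image (f := forestWeight) hinj.injOn, ← Finset.sum_union hd]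
    rfl
  rw [hsum, forestWeight]
  cases Q with
  | nil =>
    have : (extensions (forestWord [])).card = 1 := by
      rw [Finset.card_eq_one]
      refine ⟨1, ?_⟩
      ext v
      simp [mem_extensions, Extends, forestWord, forestSize, bfsAux]
      omega
    simp [this, forestSeries_zero 1]
  | cons t ts =>
    obtain ⟨d, hd⟩ := Nat.exists_eq_add_of_le' (two_le_card_extensions hQ.2.1
      (by rw [forestWord_cons]; simp))
    rw [hd]
    rcases ts with _ | ⟨u, us⟩
    · simpa using forestSeries_one d
    · simpa [add_assoc] using forestSeries_add_two us.length d

theorem card_goodUB (n : ℕ) :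
    Nat.card {t : UBTree // t.size = n ∧ IsGoodUB t} =
      ((level forestNext [] n).filter fun Q => Q.length = 1).card := by
  rw [← Nat.card_eq_finsetCard]
  have key : ∀ t : UBTree, (t.size = n ∧ IsGoodUB t) ↔
      [t] ∈ (level forestNext [] n).filter fun Q => Q.length = 1 := by
    intro t
    have h1 : forestSize [t] = t.size := by simp [forestSize]
    have h2 : t.bfs = forestWord [t] := by rw [UBTree.bfs, forestWord, h1]
    rw [Finset.mem_filter, mem_level_forestNext, h1, GoodForest, ← perm_range'_iff_isStandard,
      length_forestWord, h1, ← avoids213_iff_avoiding, IsGoodUB, h2]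
    simp
  refine Nat.card_congr (Equiv.ofBijective (fun t => ⟨[t.1], (key t.1).1 t.2⟩) ⟨?_, ?_⟩)
  · intro t u h
    simpa [Subtype.ext_iff] using h
  · rintro ⟨Q, hQ⟩
    obtain ⟨t, rfl⟩ := List.length_eq_one_iff.1 (Finset.mem_filter.1 hQ).2
    exact ⟨⟨t, (key t).2 hQ⟩, rfl⟩

end Forests

/-- The number of `n`-step G-walks equals the number of `n`-vertex increasing
unary-binary trees with associated permutation avoiding 213. -/
theorem stmt3 (n : ℕ) :
    Nat.card {s : List ℤ // IsGWalk s ∧ s.length = n} =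
    Nat.card {t : UBTree // t.size = n ∧ IsGoodUB t} := by
  rw [card_gWalk, card_goodUB]
  refine eq_of_expansion_eq
    (a := fun n => ((level walkNext [] n).filter fun s => s.sum = 1).card)
    (b := fun n => ((level forestNext [] n).filter fun Q => Q.length = 1).card)
    (S := PowerSeries.X) lengthSeries_ne_zero
    constantCoeff_lengthSeries (fun N => ?_) (fun N => ?_) n
  · have h := level_expansion dropLast_of_mem_walkNext
      (fun _ _ hs => walkSeries_sum_next (sum_nonneg_of_mem_level hs)) N
    simp only [← Nat.cast_sum, ← Finset.card_filter] at h
    exact ⟨_, h⟩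
  · have h := level_expansion forestPop_of_mem_forestNext
      (fun _ _ hs => forestWeight_expand (mem_level_forestNext.1 hs).2) N
    simp only [← Nat.cast_sum, ← Finset.card_filter] at h
    exact ⟨_, h⟩
end
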